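/- For every ε > 0 there exists a homotopically non-trivial C¹ map from S^4 to S^3 with 3-dilation less than ε. (The class of such a map is the suspension of the Hopf fibration, the non-trivial element of π_4(S^3) ≅ ℤ/2.) -/

import Mathlib

/-!
Basic notions: the unit sphere `S^{d-1} ⊆ ℝ^d`, the norm `‖Λ^k A‖` of the induced map on
`k`-th exterior powers of a linear map between inner product spaces, and the `k`-dilation of a
`C¹` map between unit spheres.  A (`C¹`) map from `S^{d₁-1}` to `S^{d₂-1}` is represented by a
(`C¹`) ambient map `F : ℝ^{d₁} → ℝ^{d₂}` mapping the unit sphere into the unit sphere; its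
`k`-dilation only depends on the restriction of `F` to the sphere, since the derivative is
restricted to the tangent space of the sphere.
-/

open scoped RealInnerProductSpace
open Set

noncomputable section

abbrev EucA (d : ℕ) := EuclideanSpace ℝ (Fin d)

/-- The unit sphere `S^{d-1}` in `ℝ^d` (with the round metric induced from `ℝ^d`). -/
def usph (d : ℕ) : Set (EucA d) := Metric.sphere 0 1

/-- The operator norm `‖Λ^k A‖` of the induced map on `k`-th exterior powers (with their induced
inner products): the supremum, over orthonormal `k`-frames `v` of the domain, of the `k`-volume
`√ det (⟪A vᵢ, A vⱼ⟫)` of the image frame `A v₁, …, A v_k`. -/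
noncomputable def lamNorm {E F : Type*} [NormedAddCommGroup E] [InnerProductSpace ℝ E]
    [NormedAddCommGroup F] [InnerProductSpace ℝ F] (k : ℕ) (A : E →ₗ[ℝ] F) : ℝ :=
  ⨆ v : {v : Fin k → E // Orthonormal ℝ v},
    Real.sqrt (Matrix.of fun (i j : Fin k) => ⟪A (v.1 i), A (v.1 j)⟫).det

/-- The `k`-dilation of a map of the unit sphere `S^{d-1}` into an inner product space (e.g. into
`ℝ^{d₂}`, for a map to the sphere `S^{d₂-1}`), the map being given by an ambient map `F`: the
supremum over points `x` of the sphere of `‖Λ^k df_x‖`, where `df_x` is the derivative of `F` at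
`x` restricted to the tangent space `(ℝ∙x)ᗮ` of the sphere at `x`. -/
noncomputable def kDilation {d : ℕ} {F' : Type*} [NormedAddCommGroup F']
    [InnerProductSpace ℝ F'] (k : ℕ) (F : EucA d → F') : ℝ :=
  ⨆ x : usph d,
    lamNorm k ((fderiv ℝ F (x : EucA d)).toLinearMap ∘ₗ ((ℝ ∙ (x : EucA d))ᗮ).subtype)

/-- A free homotopy, through maps of the unit sphere `S^{d-1}` into `T`, between (the
restrictions to the sphere of) `f` and `g`: a map `H` on `[0,1] × S^{d-1}`, continuous there,
with values in `T`, starting at `f` and ending at `g`. -/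
def FreelyHomotopic {d : ℕ} {E : Type*} [NormedAddCommGroup E] (T : Set E)
    (f g : EucA d → E) : Prop :=
  ∃ H : ℝ → EucA d → E,
    ContinuousOn (fun q : ℝ × EucA d => H q.1 q.2) (Icc (0:ℝ) 1 ×ˢ usph d) ∧
    (∀ t ∈ Icc (0:ℝ) 1, MapsTo (H t) (usph d) T) ∧
    EqOn (H 0) f (usph d) ∧ EqOn (H 1) g (usph d)

/-- A based homotopy (rel the basepoint `x₀` of the sphere, with basepoint value `y₀`), through
maps of the unit sphere `S^{d-1}` into `T`, between `f` and `g`. -/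
def BasedHomotopic {d : ℕ} {E : Type*} [NormedAddCommGroup E] (T : Set E)
    (x₀ : EucA d) (y₀ : E) (f g : EucA d → E) : Prop :=
  ∃ H : ℝ → EucA d → E,
    ContinuousOn (fun q : ℝ × EucA d => H q.1 q.2) (Icc (0:ℝ) 1 ×ˢ usph d) ∧
    (∀ t ∈ Icc (0:ℝ) 1, MapsTo (H t) (usph d) T) ∧
    (∀ t ∈ Icc (0:ℝ) 1, H t x₀ = y₀) ∧
    EqOn (H 0) f (usph d) ∧ EqOn (H 1) g (usph d)

/-- A sphere-valued map is nullhomotopic if it is freely homotopic, through sphere maps, to a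
constant map; a map is homotopically non-trivial if it is not nullhomotopic. -/
def SphereNullhomotopic {d₁ d₂ : ℕ} (F : EucA d₁ → EucA d₂) : Prop :=
  ∃ y ∈ usph d₂, FreelyHomotopic (usph d₂) F (fun _ => y)

section CubicalCochains

open Finset

variable {ι : Type*} [DecidableEq ι]

/-- The lattice point adjacent to `v` in direction `j`. -/
def stp (v : ι → ℕ) (j : ι) : ι → ℕ := v + Pi.single j 1

/-- The cubical cup product `ds₁ ∪ ⋯ ∪ ds_k ∪ c` (coefficients mod 2) of coboundaries of the
vertex functions `s₁, …, s_k` and of the vertex function `c`, evaluated on the cube spanned at `v`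
by the directions in `J`. -/
def cupW (c : (ι → ℕ) → ZMod 2) : List ((ι → ℕ) → ZMod 2) → Finset ι → (ι → ℕ) → ZMod 2
  | [], _, v => c v
  | s :: L, J, v => ∑ j ∈ J, (s v + s (stp v j)) * cupW c L (J.erase j) (stp v j)

theorem stp_comm (v : ι → ℕ) (i j : ι) : stp (stp v i) j = stp (stp v j) i := by
  simp only [stp]; abel

theorem sum_erase_symm_eq_zero (J : Finset ι) (X : ι → ι → ZMod 2) (hX : ∀ i j, X i j = X j i) :
    ∑ j ∈ J, ∑ i ∈ J.erase j, X i j = 0 := by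
  rw [Finset.sum_sigma']
  refine Finset.sum_involution (fun p _ => ⟨p.2, p.1⟩) ?_ ?_ ?_ ?_
  · rintro ⟨a, b⟩ _
    simp only [hX a b]
    exact CharTwo.add_self_eq_zero _
  · rintro ⟨a, b⟩ h _ h'
    simp only [Finset.mem_sigma, Finset.mem_erase] at h
    simp only [Sigma.mk.injEq] at h'
    exact h.2.1 h'.1
  · rintro ⟨a, b⟩ h
    simp only [Finset.mem_sigma, Finset.mem_erase] at h ⊢
    exact ⟨h.2.2, fun e => h.2.1 e.symm, h.1⟩
  · rintro ⟨a, b⟩ _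
    rfl

theorem cupW_coboundary (c : (ι → ℕ) → ZMod 2) (L : List ((ι → ℕ) → ZMod 2)) :
    ∀ (J : Finset ι) (v : ι → ℕ),
      ∑ j ∈ J, (cupW c L (J.erase j) v + cupW c L (J.erase j) (stp v j)) =
        cupW (fun _ => 1) (L ++ [c]) J v := by
  induction L with
  | nil => intro J v; simp [cupW]
  | cons s L ih =>
    intro J v
    have hswap : ∀ Y : ι → ι → ZMod 2,
        ∑ j ∈ J, ∑ i ∈ J.erase j, Y i j = ∑ i ∈ J, ∑ j ∈ J.erase i, Y i j := by
      intro Y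
      refine Finset.sum_comm' fun a b => ?_
      simp only [Finset.mem_erase]
      tauto
    have hzero := sum_erase_symm_eq_zero J
      (fun i j => (s v + s (stp v i) + s (stp v j) + s (stp (stp v i) j)) *
        cupW c L ((J.erase i).erase j) (stp (stp v i) j)) (fun i j => by
          rw [stp_comm v i j, Finset.erase_right_comm]; ring)
    have hR : cupW (fun _ => 1) (s :: L ++ [c]) J v =
        ∑ j ∈ J, ∑ i ∈ J.erase j, (s v + s (stp v i)) *
          (cupW c L ((J.erase i).erase j) (stp v i) +
            cupW c L ((J.erase i).erase j) (stp (stp v i) j)) := by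
      rw [hswap, List.cons_append, cupW]
      refine Finset.sum_congr rfl fun i _ => ?_
      rw [← ih, Finset.mul_sum]
    rw [hR, ← add_zero (Finset.sum _ _), ← hzero, ← Finset.sum_add_distrib]
    refine Finset.sum_congr rfl fun j _ => ?_
    simp only [cupW]
    rw [← Finset.sum_add_distrib, ← Finset.sum_add_distrib]
    refine Finset.sum_congr rfl fun i _ => ?_
    rw [stp_comm v j i, Finset.erase_right_comm (a := j)]
    generalize cupW c L ((J.erase i).erase j) (stp v i) = A
    generalize cupW c L ((J.erase i).erase j) (stp (stp v i) j) = B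
    generalize s v = a; generalize s (stp v i) = b; generalize s (stp v j) = d
    generalize s (stp (stp v i) j) = e
    revert A B a b d e; decide

/-- The vertices of the cube spanned at `v` by the directions in `J`. -/
def cubeV (J : Finset ι) (v : ι → ℕ) : Set (ι → ℕ) :=
  {p | ∀ i, v i ≤ p i ∧ p i ≤ v i + 1 ∧ (i ∉ J → p i = v i)}

theorem self_mem_cubeV {κ : Type*} (J : Finset κ) (v : κ → ℕ) : v ∈ cubeV J v :=
  fun i => ⟨le_rfl, by omega, fun _ => rfl⟩

theorem stp_apply (v : ι → ℕ) (j i : ι) : stp v j i = v i + if i = j then 1 else 0 := by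
  simp [stp, Pi.single_apply]

theorem cubeV_erase_stp_subset {J : Finset ι} {j : ι} (hj : j ∈ J) (v : ι → ℕ) :
    cubeV (J.erase j) (stp v j) ⊆ cubeV J v := by
  intro p hp i
  have h := hp i
  rw [stp_apply] at h
  by_cases hij : i = j
  · subst hij
    simp only [if_true, Finset.mem_erase, ne_eq, not_true_eq_false, false_and, not_false_eq_true,
      true_implies] at h
    exact ⟨by omega, by omega, fun h' => absurd hj h'⟩
  · simp only [hij, if_false, Finset.mem_erase, ne_eq, not_false_eq_true, true_and] at h
    exact ⟨by omega, by omega, fun h' => by have := h.2.2 h'; omega⟩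

theorem exists_of_cupW_ne_zero (c : (ι → ℕ) → ZMod 2) (L : List ((ι → ℕ) → ZMod 2)) :
    ∀ (J : Finset ι) (v : ι → ℕ), cupW c L J v ≠ 0 →
      (∀ s ∈ L, ∃ p ∈ cubeV J v, ∃ q ∈ cubeV J v, s p ≠ s q) ∧ ∃ p ∈ cubeV J v, c p ≠ 0 := by
  induction L with
  | nil => exact fun J v h => ⟨by simp, v, self_mem_cubeV J v, h⟩
  | cons s L ih =>
    intro J v h
    obtain ⟨j, hj, hne⟩ := Finset.exists_ne_zero_of_sum_ne_zero h
    have h1 := left_ne_zero_of_mul hne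
    obtain ⟨h2, p, hp, hc⟩ := ih _ _ (right_ne_zero_of_mul hne)
    have hsub := cubeV_erase_stp_subset hj v
    refine ⟨?_, p, hsub hp, hc⟩
    intro s' hs'
    rcases List.mem_cons.1 hs' with rfl | hs'
    · refine ⟨v, self_mem_cubeV J v, stp v j, hsub (self_mem_cubeV _ _), fun e => h1 ?_⟩
      rw [e]; exact CharTwo.add_self_eq_zero _
    · obtain ⟨p, hp, q, hq, hpq⟩ := h2 s' hs'
      exact ⟨p, hsub hp, q, hsub hq, hpq⟩

theorem stp_update {k j : ι} (hjk : j ≠ k) (v : ι → ℕ) (a : ℕ) :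
    stp (Function.update v k a) j = Function.update (stp v j) k a := by
  funext i
  rw [stp_apply]
  by_cases hi : i = k
  · subst hi; simp [Ne.symm hjk]
  · simp [hi, stp_apply]

/-- Two parallel faces on which the vertex functions agree up to additive constants. -/
theorem cupW_update_eq (c : (ι → ℕ) → ZMod 2) (k : ι) (a : ℕ)
    (hc : ∀ v, v k = 0 → c (Function.update v k a) = c v) (L : List ((ι → ℕ) → ZMod 2))
    (hL : ∀ s ∈ L, ∃ e, ∀ v, v k = 0 → s (Function.update v k a) = e + s v) :
    ∀ (J : Finset ι) (v : ι → ℕ), k ∉ J → v k = 0 →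
      cupW c L J (Function.update v k a) = cupW c L J v := by
  induction L with
  | nil => exact fun J v _ h => hc v h
  | cons s L ih =>
    intro J v hk hv
    obtain ⟨e, he⟩ := hL s (by simp)
    simp only [cupW]
    refine Finset.sum_congr rfl fun j hj => ?_
    have hjk : j ≠ k := fun h => hk (h ▸ hj)
    have hv' : stp v j k = 0 := by rw [stp_apply]; simp [hv, Ne.symm hjk]
    rw [stp_update hjk, ih (fun s' h' => hL s' (List.mem_cons_of_mem _ h')) _ _
      (fun h => hk (Finset.mem_of_mem_erase h)) hv', he v hv, he _ hv']
    congr 1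
    have : ∀ x y z : ZMod 2, x + y + (x + z) = y + z := by decide
    exact this _ _ _

/-- Evaluation of the cup product when the first vertex function jumps in one direction only. -/
theorem cupW_cons_of_step (c s : (ι → ℕ) → ZMod 2) (L : List ((ι → ℕ) → ZMod 2)) (J : Finset ι)
    (v : ι → ℕ) {k : ι} (hk : k ∈ J) (h : ∀ j ∈ J, j ≠ k → s (stp v j) = s v) :
    cupW c (s :: L) J v = (s v + s (stp v k)) * cupW c L (J.erase k) (stp v k) := by
  rw [cupW]
  refine Finset.sum_eq_single_of_mem k hk fun j hj hjk => ?_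
  rw [h j hj hjk, CharTwo.add_self_eq_zero, zero_mul]

variable [Fintype ι]

/-- The lattice box `∏ [0, N i)`. -/
def latBox (N : ι → ℕ) : Finset (ι → ℕ) := Fintype.piFinset fun i => range (N i)

theorem sum_range_char_two (m : ℕ) (f : ℕ → ZMod 2) :
    ∑ k ∈ range m, (f k + f (k + 1)) = f 0 + f m := by
  have h := Finset.sum_range_sub f m
  have e : ∀ a b : ZMod 2, a - b = b + a := by decide
  simp only [e] at h
  exact h

theorem sum_latBox_telescope (N : ι → ℕ) (hN : ∀ i, 0 < N i) (j : ι) (g : (ι → ℕ) → ZMod 2) :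
    ∑ v ∈ latBox N, (g v + g (stp v j)) =
      ∑ w ∈ (latBox N).filter (fun w => w j = 0), (g w + g (Function.update w j (N j))) := by
  rw [← Finset.sum_fiberwise_of_maps_to (g := fun v => Function.update v j 0)
    (t := (latBox N).filter (fun w => w j = 0))]
  · refine Finset.sum_congr rfl fun w hw => ?_
    simp only [Finset.mem_filter, latBox, Fintype.mem_piFinset, Finset.mem_range] at hw
    have e : g w + g (Function.update w j (N j)) = ∑ k ∈ range (N j),
        (g (Function.update w j k) + g (Function.update w j (k + 1))) := by
      rw [sum_range_char_two (N j) (fun k => g (Function.update w j k))]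
      congr 2
      rw [← hw.2, Function.update_eq_self]
    rw [e]
    refine Finset.sum_bij' (fun v _ => v j) (fun k _ => Function.update w j k) ?_ ?_ ?_ ?_ ?_
    · intro v hv
      simp only [Finset.mem_filter, latBox, Fintype.mem_piFinset, Finset.mem_range] at hv ⊢
      exact hv.1 j
    · intro k hk
      simp only [Finset.mem_filter, latBox, Fintype.mem_piFinset, Finset.mem_range] at hk ⊢
      refine ⟨fun i => ?_, ?_⟩
      · by_cases hi : i = j
        · subst hi; simpa using hk
        · simpa [hi] using hw.1 i
      · rw [Function.update_idem, ← hw.2, Function.update_eq_self]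
    · intro v hv
      simp only [Finset.mem_filter] at hv
      rw [← hv.2, Function.update_idem, Function.update_eq_self]
    · intro k _; simp
    · intro v hv
      simp only [Finset.mem_filter] at hv
      rw [← hv.2, Function.update_idem, Function.update_idem, Function.update_eq_self]
      congr 2
      funext i
      rw [stp_apply]
      by_cases hi : i = j
      · subst hi; simp
      · simp [hi]
  · intro v hv
    simp only [Finset.mem_filter, latBox, Fintype.mem_piFinset, Finset.mem_range] at hv ⊢
    refine ⟨fun i => ?_, by simp⟩
    by_cases hi : i = j
    · subst hi; simpa using hN i
    · simpa [hi] using hv i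

/-- Mod 2 Stokes for a box. -/
theorem sum_faces_eq_zero (c : (ι → ℕ) → ZMod 2) (L : List ((ι → ℕ) → ZMod 2)) (N : ι → ℕ)
    (hN : ∀ i, 0 < N i)
    (h : ∀ v ∈ latBox N, cupW (fun _ => 1) (L ++ [c]) univ v = 0) :
    ∑ j, ∑ w ∈ (latBox N).filter (fun w => w j = 0),
      (cupW c L (univ.erase j) w + cupW c L (univ.erase j) (Function.update w j (N j))) = 0 := by
  rw [← Finset.sum_congr rfl fun j _ => sum_latBox_telescope N hN j (cupW c L (univ.erase j)),
    Finset.sum_comm]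
  exact Finset.sum_eq_zero fun v hv => (cupW_coboundary c L univ v).trans (h v hv)

end CubicalCochains

section Configurations

open Finset

/-- Sign of a real number as a bit. -/
def sgnBit (x : ℝ) : ZMod 2 := if 0 ≤ x then 1 else 0

/-- The sums and differences of the coordinates of two vectors which have to vanish at a pair of
opposite points. -/
def pairForms (X Y : Fin 4 → ℝ) : Fin 6 → ℝ :=
  ![Y 3 - X 3, X 3 + Y 3, Y 2 - X 2, X 1 - Y 1, X 1 + Y 1, X 2 + Y 2]

/-- How the signs of `pairForms` change when the pair is rotated by half a turn. -/
def flipBit : Fin 6 → ZMod 2 := ![1, 0, 1, 0, 1, 0]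

/-- Rotation of the first two coordinates by the angle `-φ`. -/
def rotXY (φ : ℝ) (w : Fin 4 → ℝ) : Fin 4 → ℝ :=
  ![w 0 * Real.cos φ + w 1 * Real.sin φ, w 1 * Real.cos φ - w 0 * Real.sin φ, w 2, w 3]

/-- A polynomial model for the suspended Hopf map, in affine coordinates. -/
def hopfPoly (u : Fin 4 → ℝ) : Fin 4 → ℝ :=
  ![2 * u 0 * u 2 - u 1 * (u 0 ^ 2 + u 1 ^ 2 - 1), u 0 * (u 0 ^ 2 + u 1 ^ 2 - 1) + 2 * u 1 * u 2,
    4 * u 2 ^ 2 + (u 0 ^ 2 + u 1 ^ 2 - 1) ^ 2 - 1 / 4, u 3]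

/-- First point of the pair with parameters `p` (time, midpoint, distance, angle). -/
def pairFst (p : Fin 7 → ℝ) : Fin 4 → ℝ :=
  ![p 1, p 2, p 3 - p 5 / 2 * Real.sin (p 6), p 4 + p 5 / 2 * Real.cos (p 6)]

/-- Second point of the pair with parameters `p`. -/
def pairSnd (p : Fin 7 → ℝ) : Fin 4 → ℝ :=
  ![p 1, p 2, p 3 + p 5 / 2 * Real.sin (p 6), p 4 - p 5 / 2 * Real.cos (p 6)]

/-- The parameters of a lattice point. -/
def latPar (n M : ℕ) (r₀ : ℝ) (v : Fin 7 → ℕ) : Fin 7 → ℝ :=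
  ![v 0 / n, v 1 / n - M, v 2 / n - M, v 3 / n - M, v 4 / n - M, r₀ + v 5 / n,
    Real.pi * v 6 / (2 * n)]

/-- Size of the box of lattice points. -/
def latSize (n M : ℕ) : Fin 7 → ℕ :=
  ![n, 2 * M * n, 2 * M * n, 2 * M * n, 2 * M * n, 2 * M * n, 2 * n]

/-- The vertex functions recording the signs of `pairForms`. -/
def signV (X Y : (Fin 7 → ℝ) → Fin 4 → ℝ) (n M : ℕ) (r₀ : ℝ) (k : Fin 6) (v : Fin 7 → ℕ) :
    ZMod 2 :=
  if v 6 = 2 * n then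
    flipBit k + sgnBit (pairForms (X (latPar n M r₀ (Function.update v 6 0)))
      (Y (latPar n M r₀ (Function.update v 6 0))) k)
  else sgnBit (pairForms (X (latPar n M r₀ v)) (Y (latPar n M r₀ v)) k)

/-- The vertex function recording whether the pair is opposite, with the right order. -/
def oppV (X Y : (Fin 7 → ℝ) → Fin 4 → ℝ) (n M : ℕ) (r₀ : ℝ) (v : Fin 7 → ℕ) : ZMod 2 :=
  if 0 < Y (latPar n M r₀ v) 0 ∧ X (latPar n M r₀ v) 0 < 0 then 1 else 0

/-- The list of all the functions `signV`. -/
def signL (X Y : (Fin 7 → ℝ) → Fin 4 → ℝ) (n M : ℕ) (r₀ : ℝ) : List ((Fin 7 → ℕ) → ZMod 2) :=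
  [signV X Y n M r₀ 0, signV X Y n M r₀ 1, signV X Y n M r₀ 2, signV X Y n M r₀ 3,
    signV X Y n M r₀ 4, signV X Y n M r₀ 5]

section Initial

variable {X Y : (Fin 7 → ℝ) → Fin 4 → ℝ} {n M : ℕ} {r₀ : ℝ}

theorem signV_zero (hX : ∀ p, p 0 = 0 → X p = rotXY (p 6) (hopfPoly (pairFst p)))
    (hY : ∀ p, p 0 = 0 → Y p = rotXY (p 6) (hopfPoly (pairSnd p))) (hn : 2 ≤ n) (hr : 0 < r₀)
    {v : Fin 7 → ℕ} (h0 : v 0 = 0) (h6 : v 6 ≤ 2 * n) :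
    signV X Y n M r₀ 0 v = if n ≤ v 6 then 1 else 0 := by
  have hn' : (0:ℝ) < n := by exact_mod_cast (by omega : 0 < n)
  have key : ∀ w : Fin 7 → ℕ, w 0 = 0 → w 6 < 2 * n →
      sgnBit (pairForms (X (latPar n M r₀ w)) (Y (latPar n M r₀ w)) 0) =
        if n ≤ w 6 then 1 else 0 := by
    intro w hw0 hw6
    have hp0 : latPar n M r₀ w 0 = 0 := by simp [latPar, hw0]
    have hr5 : 0 < latPar n M r₀ w 5 := by
      simp only [latPar, Matrix.cons_val]; positivity
    have e : pairForms (X (latPar n M r₀ w)) (Y (latPar n M r₀ w)) 0 =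
        - (latPar n M r₀ w 5 * Real.cos (latPar n M r₀ w 6)) := by
      rw [hX _ hp0, hY _ hp0]
      simp only [pairForms, rotXY, hopfPoly, pairFst, pairSnd, Matrix.cons_val]
      ring
    have h6e : latPar n M r₀ w 6 = Real.pi * w 6 / (2 * n) := rfl
    have hpi := Real.pi_pos
    have hw6' : (w 6 : ℝ) < 2 * n := by exact_mod_cast hw6
    rw [sgnBit, e]
    congr 1
    rw [eq_iff_iff, neg_nonneg]
    constructor
    · intro h
      by_contra hlt
      push Not at hlt
      have hlt' : (w 6 : ℝ) < n := by exact_mod_cast hlt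
      have : 0 < Real.cos (latPar n M r₀ w 6) := by
        apply Real.cos_pos_of_mem_Ioo
        rw [h6e]
        constructor
        · have : 0 ≤ Real.pi * w 6 / (2 * n) := by positivity
          linarith
        · rw [div_lt_div_iff₀ (by positivity) (by norm_num)]
          nlinarith
      nlinarith [mul_pos hr5 this]
    · intro h
      have h' : (n : ℝ) ≤ w 6 := by exact_mod_cast h
      have : Real.cos (latPar n M r₀ w 6) ≤ 0 := by
        apply Real.cos_nonpos_of_pi_div_two_le_of_le
        · rw [h6e, div_le_div_iff₀ (by norm_num) (by positivity)]
          nlinarith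
        · rw [h6e]
          have : Real.pi * w 6 / (2 * n) ≤ Real.pi := by
            rw [div_le_iff₀ (by positivity)]; nlinarith
          linarith
      nlinarith
  by_cases h : v 6 = 2 * n
  · rw [signV, if_pos h, key _ (by simp [h0]) (by simp; omega)]
    simp only [Function.update_self, flipBit, Matrix.cons_val]
    rw [if_neg (by omega), if_pos (by omega), add_zero]
  · rw [signV, if_neg h, key v h0 (by omega)]

theorem initial_values (hX : ∀ p, p 0 = 0 → X p = rotXY (p 6) (hopfPoly (pairFst p)))
    (hY : ∀ p, p 0 = 0 → Y p = rotXY (p 6) (hopfPoly (pairSnd p))) (hn : 2 ≤ n) (hr : 0 < r₀)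
    {v : Fin 7 → ℕ} (h0 : v 0 = 0) (h6 : v 6 = n) :
    X (latPar n M r₀ v) = rotXY (Real.pi / 2) (hopfPoly ![latPar n M r₀ v 1, latPar n M r₀ v 2,
        latPar n M r₀ v 3 - latPar n M r₀ v 5 / 2, latPar n M r₀ v 4]) ∧
    Y (latPar n M r₀ v) = rotXY (Real.pi / 2) (hopfPoly ![latPar n M r₀ v 1, latPar n M r₀ v 2,
        latPar n M r₀ v 3 + latPar n M r₀ v 5 / 2, latPar n M r₀ v 4]) ∧
    0 < latPar n M r₀ v 5 ∧
    ∀ k, signV X Y n M r₀ k v =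
      sgnBit (pairForms (X (latPar n M r₀ v)) (Y (latPar n M r₀ v)) k) := by
  have hn' : (0:ℝ) < n := by exact_mod_cast (by omega : 0 < n)
  have hp0 : latPar n M r₀ v 0 = 0 := by simp [latPar, h0]
  have hp6 : latPar n M r₀ v 6 = Real.pi / 2 := by
    simp only [latPar, Matrix.cons_val, h6]; field_simp
  refine ⟨?_, ?_, ?_, fun k => ?_⟩
  · rw [hX _ hp0, pairFst, hp6]; simp
  · rw [hY _ hp0, pairSnd, hp6]; simp
  · simp only [latPar, Matrix.cons_val]; positivity
  · rw [signV, if_neg (by omega)]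

theorem latPar_nonneg_iff (hn : 2 ≤ n) {a : ℕ} : (0:ℝ) ≤ a / n - M ↔ n * M ≤ a := by
  have hn' : (0:ℝ) < n := by exact_mod_cast (by omega : 0 < n)
  rw [sub_nonneg, le_div_iff₀ hn', mul_comm]
  exact_mod_cast Iff.rfl

theorem signV_one (hX : ∀ p, p 0 = 0 → X p = rotXY (p 6) (hopfPoly (pairFst p)))
    (hY : ∀ p, p 0 = 0 → Y p = rotXY (p 6) (hopfPoly (pairSnd p))) (hn : 2 ≤ n) (hr : 0 < r₀)
    {v : Fin 7 → ℕ} (h0 : v 0 = 0) (h6 : v 6 = n) :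
    signV X Y n M r₀ 1 v = if n * M ≤ v 4 then 1 else 0 := by
  obtain ⟨eX, eY, hr5, hs⟩ := initial_values (M := M) hX hY hn hr h0 h6
  rw [hs, eX, eY, sgnBit]
  congr 1
  rw [← latPar_nonneg_iff hn, eq_iff_iff, show (v 4 : ℝ) / n - M = latPar n M r₀ v 4 from rfl]
  simp only [pairForms, rotXY, hopfPoly, Matrix.cons_val]
  constructor <;> intro h <;> linarith

theorem signV_two (hX : ∀ p, p 0 = 0 → X p = rotXY (p 6) (hopfPoly (pairFst p)))
    (hY : ∀ p, p 0 = 0 → Y p = rotXY (p 6) (hopfPoly (pairSnd p))) (hn : 2 ≤ n) (hr : 0 < r₀)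
    {v : Fin 7 → ℕ} (h0 : v 0 = 0) (h6 : v 6 = n) :
    signV X Y n M r₀ 2 v = if n * M ≤ v 3 then 1 else 0 := by
  obtain ⟨eX, eY, hr5, hs⟩ := initial_values (M := M) hX hY hn hr h0 h6
  rw [hs, eX, eY, sgnBit]
  congr 1
  rw [← latPar_nonneg_iff hn, eq_iff_iff, show (v 3 : ℝ) / n - M = latPar n M r₀ v 3 from rfl,
    ← mul_nonneg_iff_of_pos_right (b := latPar n M r₀ v 3) hr5]
  simp only [pairForms, rotXY, hopfPoly, Matrix.cons_val]
  constructor <;> intro h <;> linarith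

theorem signV_three (hX : ∀ p, p 0 = 0 → X p = rotXY (p 6) (hopfPoly (pairFst p)))
    (hY : ∀ p, p 0 = 0 → Y p = rotXY (p 6) (hopfPoly (pairSnd p))) (hn : 2 ≤ n) (hr : 0 < r₀)
    {v : Fin 7 → ℕ} (h0 : v 0 = 0) (h6 : v 6 = n) :
    signV X Y n M r₀ 3 v = if n * M ≤ v 1 then 1 else 0 := by
  obtain ⟨eX, eY, hr5, hs⟩ := initial_values (M := M) hX hY hn hr h0 h6
  rw [hs, eX, eY, sgnBit]
  congr 1
  rw [← latPar_nonneg_iff hn, eq_iff_iff, show (v 1 : ℝ) / n - M = latPar n M r₀ v 1 from rfl,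
    ← mul_nonneg_iff_of_pos_right (b := latPar n M r₀ v 1) hr5]
  simp only [pairForms, rotXY, hopfPoly, Matrix.cons_val, Real.cos_pi_div_two,
    Real.sin_pi_div_two]
  constructor <;> intro h <;> linarith

theorem latPar_eq_zero (hn : 2 ≤ n) {a : ℕ} (ha : a = n * M) : (a:ℝ) / n - M = 0 := by
  have hn' : (0:ℝ) < n := by exact_mod_cast (by omega : 0 < n)
  rw [ha]; push_cast; field_simp; simp

theorem signV_four (hX : ∀ p, p 0 = 0 → X p = rotXY (p 6) (hopfPoly (pairFst p)))
    (hY : ∀ p, p 0 = 0 → Y p = rotXY (p 6) (hopfPoly (pairSnd p))) (hn : 2 ≤ n) (hr : 0 < r₀)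
    {v : Fin 7 → ℕ} (h0 : v 0 = 0) (h6 : v 6 = n) (h1 : v 1 = n * M) :
    signV X Y n M r₀ 4 v = sgnBit (((v 2 : ℝ) / n - M) * (((v 2 : ℝ) / n - M) ^ 2 - 1)) := by
  obtain ⟨eX, eY, hr5, hs⟩ := initial_values (M := M) hX hY hn hr h0 h6
  have e1 : latPar n M r₀ v 1 = 0 := latPar_eq_zero hn h1
  rw [hs, eX, eY, sgnBit, sgnBit, e1, show (v 2 : ℝ) / n - M = latPar n M r₀ v 2 from rfl]
  congr 1
  rw [eq_iff_iff]
  simp only [pairForms, rotXY, hopfPoly, Matrix.cons_val, Real.cos_pi_div_two,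
    Real.sin_pi_div_two]
  constructor <;> intro h <;> linarith

theorem signV_five (hX : ∀ p, p 0 = 0 → X p = rotXY (p 6) (hopfPoly (pairFst p)))
    (hY : ∀ p, p 0 = 0 → Y p = rotXY (p 6) (hopfPoly (pairSnd p))) (hn : 2 ≤ n) (hr : 0 < r₀)
    {v : Fin 7 → ℕ} (h0 : v 0 = 0) (h6 : v 6 = n) (h1 : v 1 = n * M)
    (h3 : v 3 = n * M) : signV X Y n M r₀ 5 v =
      sgnBit ((r₀ + v 5 / n) ^ 2 + (((v 2 : ℝ) / n - M) ^ 2 - 1) ^ 2 - 1 / 4) := by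
  obtain ⟨eX, eY, hr5, hs⟩ := initial_values (M := M) hX hY hn hr h0 h6
  have e1 : latPar n M r₀ v 1 = 0 := latPar_eq_zero hn h1
  have e3 : latPar n M r₀ v 3 = 0 := latPar_eq_zero hn h3
  rw [hs, eX, eY, sgnBit, sgnBit, e1, e3, show (v 2 : ℝ) / n - M = latPar n M r₀ v 2 from rfl,
    show r₀ + (v 5 : ℝ) / n = latPar n M r₀ v 5 from rfl]
  congr 1
  rw [eq_iff_iff]
  simp only [pairForms, rotXY, hopfPoly, Matrix.cons_val]
  constructor <;> intro h <;> linarith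

theorem oppV_initial (hX : ∀ p, p 0 = 0 → X p = rotXY (p 6) (hopfPoly (pairFst p)))
    (hY : ∀ p, p 0 = 0 → Y p = rotXY (p 6) (hopfPoly (pairSnd p))) (hn : 2 ≤ n) (hr : 0 < r₀)
    {v : Fin 7 → ℕ} (h0 : v 0 = 0) (h6 : v 6 = n) (h1 : v 1 = n * M)
    (h3 : v 3 = n * M) : oppV X Y n M r₀ v = if 0 < (v 2 : ℝ) / n - M then 1 else 0 := by
  obtain ⟨eX, eY, hr5, hs⟩ := initial_values (M := M) hX hY hn hr h0 h6
  have e1 : latPar n M r₀ v 1 = 0 := latPar_eq_zero hn h1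
  have e3 : latPar n M r₀ v 3 = 0 := latPar_eq_zero hn h3
  rw [oppV, eX, eY, e1, e3, show (v 2 : ℝ) / n - M = latPar n M r₀ v 2 from rfl]
  congr 1
  rw [eq_iff_iff, ← mul_pos_iff_of_pos_left (b := latPar n M r₀ v 2) hr5]
  simp only [rotXY, hopfPoly, Matrix.cons_val, Real.cos_pi_div_two, Real.sin_pi_div_two]
  constructor
  · intro h; linarith [h.1]
  · intro h; constructor <;> linarith

end Initial
end Configurations

section InitialFace

open Finset

theorem sum_step_char_two {a c : ℕ} :
    ((if c ≤ a then 1 else 0 : ZMod 2) + if c ≤ a + 1 then 1 else 0) =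
      if a + 1 = c then 1 else 0 := by
  by_cases h : a + 1 = c
  · rw [if_pos h, if_neg (by omega), if_pos (by omega), zero_add]
  · rw [if_neg h]
    by_cases h' : c ≤ a
    · rw [if_pos h', if_pos (by omega)]; decide
    · rw [if_neg h', if_neg (by omega)]; decide

/-- `sgnBit` of the residual forms on the initial face. -/
def resS (n M a : ℕ) : ZMod 2 := sgnBit (((a : ℝ) / n - M) * (((a : ℝ) / n - M) ^ 2 - 1))

def resR (n M : ℕ) (r₀ : ℝ) (a b : ℕ) : ZMod 2 :=
  sgnBit ((r₀ + b / n) ^ 2 + (((a : ℝ) / n - M) ^ 2 - 1) ^ 2 - 1 / 4)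

def resC (n M a : ℕ) : ZMod 2 := if 0 < (a : ℝ) / n - M then 1 else 0

def initialTerm (n M : ℕ) (r₀ : ℝ) (a b : ℕ) : ZMod 2 :=
  (resS n M a + resS n M (a + 1)) *
    ((resR n M r₀ (a + 1) b + resR n M r₀ (a + 1) (b + 1)) * resC n M (a + 1))

variable {X Y : (Fin 7 → ℝ) → Fin 4 → ℝ} {n M : ℕ} {r₀ : ℝ}

theorem cupW_initial (hX : ∀ p, p 0 = 0 → X p = rotXY (p 6) (hopfPoly (pairFst p)))
    (hY : ∀ p, p 0 = 0 → Y p = rotXY (p 6) (hopfPoly (pairSnd p)))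
    (hn : 2 ≤ n) (hr : 0 < r₀) {w : Fin 7 → ℕ} (h0 : w 0 = 0) (h6 : w 6 < 2 * n) :
    cupW (oppV X Y n M r₀) (signL X Y n M r₀) (univ.erase 0) w =
      if w 6 + 1 = n ∧ w 4 + 1 = n * M ∧ w 3 + 1 = n * M ∧ w 1 + 1 = n * M then
        initialTerm n M r₀ (w 2) (w 5) else 0 := by
  have z : ∀ {p : Fin 7 → ℕ} {i j : Fin 7}, i ≠ j → stp p j i = p i := by
    intro p i j h; rw [stp_apply, if_neg h, add_zero]
  have o : ∀ {p : Fin 7 → ℕ} {j : Fin 7}, stp p j j = p j + 1 := by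
    intro p j; rw [stp_apply, if_pos rfl]
  rw [signL, cupW_cons_of_step _ _ _ _ _ (k := 6) (by decide)]
  swap
  · intro j hj hj6
    have hj0 := (Finset.mem_erase.1 hj).1
    rw [signV_zero hX hY hn hr (by rw [z hj0.symm, h0]) (by rw [z hj6.symm]; omega),
      signV_zero hX hY hn hr h0 h6.le, z hj6.symm]
  rw [signV_zero hX hY hn hr h0 h6.le,
    signV_zero hX hY hn hr (v := stp w 6) (by rw [z (by decide), h0]) (by rw [o]; omega), o,
    sum_step_char_two]
  by_cases c6 : w 6 + 1 = n
  swap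
  · simp [c6]
  set w1 := stp w 6 with hw1
  have a0 : w1 0 = 0 := by rw [hw1, z (by decide), h0]
  have a6 : w1 6 = n := by rw [hw1, o, c6]
  rw [if_pos c6, one_mul, cupW_cons_of_step _ _ _ _ _ (k := 4) (by decide)]
  swap
  · intro j hj hj4
    have hj6 := (Finset.mem_erase.1 hj).1
    have hj0 := (Finset.mem_erase.1 (Finset.mem_erase.1 hj).2).1
    rw [signV_one hX hY hn hr (by rw [z hj0.symm, a0]) (by rw [z hj6.symm, a6]),
      signV_one hX hY hn hr a0 a6, z hj4.symm]
  rw [signV_one hX hY hn hr a0 a6,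
    signV_one hX hY hn hr (v := stp w1 4) (by rw [z (by decide), a0]) (by rw [z (by decide), a6]),
    o, sum_step_char_two, show w1 4 = w 4 from z (by decide)]
  by_cases c4 : w 4 + 1 = n * M
  swap
  · simp [c4]
  set w2 := stp w1 4 with hw2
  have b0 : w2 0 = 0 := by rw [hw2, z (by decide), a0]
  have b6 : w2 6 = n := by rw [hw2, z (by decide), a6]
  rw [if_pos c4, one_mul, cupW_cons_of_step _ _ _ _ _ (k := 3) (by decide)]
  swap
  · intro j hj hj3
    have hj6 := (Finset.mem_erase.1 (Finset.mem_erase.1 hj).2).1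
    have hj0 := (Finset.mem_erase.1 (Finset.mem_erase.1 (Finset.mem_erase.1 hj).2).2).1
    rw [signV_two hX hY hn hr (by rw [z hj0.symm, b0]) (by rw [z hj6.symm, b6]),
      signV_two hX hY hn hr b0 b6, z hj3.symm]
  rw [signV_two hX hY hn hr b0 b6,
    signV_two hX hY hn hr (v := stp w2 3) (by rw [z (by decide), b0]) (by rw [z (by decide), b6]),
    o, sum_step_char_two,
    show w2 3 = w 3 by rw [hw2, z (by decide), hw1, z (by decide)]]
  by_cases c3 : w 3 + 1 = n * M
  swap
  · simp [c3]
  set w3 := stp w2 3 with hw3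
  have d0 : w3 0 = 0 := by rw [hw3, z (by decide), b0]
  have d6 : w3 6 = n := by rw [hw3, z (by decide), b6]
  have d3 : w3 3 = n * M := by
    rw [hw3, o, hw2, z (by decide), hw1, z (by decide), c3]
  rw [if_pos c3, one_mul, cupW_cons_of_step _ _ _ _ _ (k := 1) (by decide)]
  swap
  · intro j hj hj3
    have hj6 : j ≠ 6 := by rintro rfl; revert hj; decide
    have hj0 : j ≠ 0 := by rintro rfl; revert hj; decide
    rw [signV_three hX hY hn hr (by rw [z hj0.symm, d0]) (by rw [z hj6.symm, d6]),
      signV_three hX hY hn hr d0 d6, z hj3.symm]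
  rw [signV_three hX hY hn hr d0 d6, signV_three hX hY hn hr (v := stp w3 1)
      (by rw [z (by decide), d0]) (by rw [z (by decide), d6]),
    o, sum_step_char_two,
    show w3 1 = w 1 by rw [hw3, z (by decide), hw2, z (by decide), hw1, z (by decide)]]
  by_cases c1 : w 1 + 1 = n * M
  swap
  · simp [c1]
  set w4 := stp w3 1 with hw4
  have e0 : w4 0 = 0 := by rw [hw4, z (by decide), d0]
  have e6 : w4 6 = n := by rw [hw4, z (by decide), d6]
  have e3 : w4 3 = n * M := by rw [hw4, z (by decide), d3]
  have e1 : w4 1 = n * M := by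
    rw [hw4, o, hw3, z (by decide), hw2, z (by decide), hw1, z (by decide), c1]
  have e2 : w4 2 = w 2 := by
    rw [hw4, z (by decide), hw3, z (by decide), hw2, z (by decide), hw1, z (by decide)]
  have e5 : w4 5 = w 5 := by
    rw [hw4, z (by decide), hw3, z (by decide), hw2, z (by decide), hw1, z (by decide)]
  rw [if_pos c1, one_mul, cupW_cons_of_step _ _ _ _ _ (k := 2) (by decide)]
  swap
  · intro j hj hj2
    have hj6 : j ≠ 6 := by rintro rfl; revert hj; decide
    have hj0 : j ≠ 0 := by rintro rfl; revert hj; decide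
    have hj1 : j ≠ 1 := by rintro rfl; revert hj; decide
    rw [signV_four hX hY hn hr (by rw [z hj0.symm, e0]) (by rw [z hj6.symm, e6])
      (by rw [z hj1.symm, e1]), signV_four hX hY hn hr e0 e6 e1, z hj2.symm]
  rw [signV_four hX hY hn hr e0 e6 e1, signV_four hX hY hn hr (v := stp w4 2)
      (by rw [z (by decide), e0]) (by rw [z (by decide), e6]) (by rw [z (by decide), e1]), o, e2]
  set w5 := stp w4 2 with hw5
  have f0 : w5 0 = 0 := by rw [hw5, z (by decide), e0]
  have f6 : w5 6 = n := by rw [hw5, z (by decide), e6]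
  have f3 : w5 3 = n * M := by rw [hw5, z (by decide), e3]
  have f1 : w5 1 = n * M := by rw [hw5, z (by decide), e1]
  have f2 : w5 2 = w 2 + 1 := by rw [hw5, o, e2]
  have f5 : w5 5 = w 5 := by rw [hw5, z (by decide), e5]
  rw [cupW_cons_of_step _ _ _ _ _ (k := 5) (by decide)]
  swap
  · intro j hj hj5
    exact absurd hj (by revert hj5; revert j; decide)
  rw [signV_five hX hY hn hr f0 f6 f1 f3, signV_five hX hY hn hr (v := stp w5 5)
      (by rw [z (by decide), f0]) (by rw [z (by decide), f6]) (by rw [z (by decide), f1])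
      (by rw [z (by decide), f3]), o, z (by decide), f2, f5, cupW,
    oppV_initial hX hY hn hr (v := stp w5 5)
      (by rw [z (by decide), f0]) (by rw [z (by decide), f6]) (by rw [z (by decide), f1])
      (by rw [z (by decide), f3]), z (by decide), f2,
    if_pos (c := w 6 + 1 = n ∧ _) ⟨c6, c4, c3, c1⟩]
  rfl

theorem resS_eq (hn : 2 ≤ n) (a : ℕ) (ha : n * M < a + 1) :
    resS n M a + resS n M (a + 1) =
      (if n * M = a then 1 else 0) + if a + 1 = n * M + n then 1 else 0 := by
  have hn' : (0:ℝ) < n := by exact_mod_cast (by omega : 0 < n)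
  have key : ∀ b : ℕ, n * M ≤ b → resS n M b = if b = n * M ∨ n * M + n ≤ b then 1 else 0 := by
    intro b hb
    rw [resS, sgnBit]
    congr 1
    rw [eq_iff_iff]
    have h0 := (latPar_nonneg_iff hn).2 hb
    have h1 : n * M + n ≤ b ↔ 0 ≤ (b : ℝ) / n - M - 1 := by
      rw [sub_sub, sub_nonneg, le_div_iff₀ hn', add_mul, one_mul, mul_comm n M]
      exact_mod_cast Iff.rfl
    have h2 : b = n * M ↔ (b : ℝ) / n - M = 0 := by
      constructor
      · exact latPar_eq_zero hn
      · intro h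
        rw [sub_eq_zero, div_eq_iff hn'.ne'] at h
        rw [mul_comm]; exact_mod_cast h
    rw [h1, h2]
    generalize (b : ℝ) / n - M = m at h0
    constructor
    · intro h
      rcases h0.eq_or_lt with h' | h'
      · exact Or.inl h'.symm
      · right
        have := nonneg_of_mul_nonneg_right h h'
        nlinarith
    · rintro (h | h)
      · simp [h]
      · apply mul_nonneg h0; nlinarith
  rw [key a (by omega), key (a + 1) (by omega)]
  by_cases h1 : a = n * M
  · rw [if_pos (Or.inl h1), if_neg (by omega), if_pos h1.symm, if_neg (by omega)]
  · rw [if_neg (c := n * M = a) (fun h => h1 h.symm), zero_add, ← sum_step_char_two]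
    congr 2 <;> rw [eq_iff_iff] <;> omega

theorem sum_initialTerm (hn : 2 ≤ n) (hM : 1 ≤ M) (hr : 0 < r₀) (hr' : r₀ < 1 / 2) :
    ∑ a ∈ range (2 * M * n), ∑ b ∈ range (2 * M * n), initialTerm n M r₀ a b = 1 := by
  have hn' : (2:ℝ) ≤ n := by exact_mod_cast hn
  have hM' : (1:ℝ) ≤ M := by exact_mod_cast hM
  have e : ∀ a, ∑ b ∈ range (2 * M * n), initialTerm n M r₀ a b =
      if a + 1 = n * M + n then 1 else 0 := by
    intro a
    simp only [initialTerm]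
    rw [← Finset.mul_sum, ← Finset.sum_mul, sum_range_char_two]
    have hc : resC n M (a + 1) = if n * M < a + 1 then 1 else 0 := by
      rw [resC]
      congr 1
      rw [eq_iff_iff, sub_pos, lt_div_iff₀ (by linarith), mul_comm]
      exact_mod_cast Iff.rfl
    rw [hc]
    by_cases h : n * M < a + 1
    swap
    · rw [if_neg h, mul_zero, mul_zero, if_neg (by omega)]
    rw [if_pos h, mul_one, resS_eq hn a h]
    have htop : resR n M r₀ (a + 1) (2 * M * n) = 1 := by
      rw [resR, sgnBit, if_pos]
      have : ((2 * M * n : ℕ) : ℝ) / n = 2 * M := by push_cast; field_simp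
      rw [this]
      nlinarith [sq_nonneg ((((a + 1 : ℕ) : ℝ) / n - M) ^ 2 - 1)]
    rw [htop]
    by_cases h1 : n * M = a
    · rw [if_pos h1, if_neg (by omega)]
      have : resR n M r₀ (a + 1) 0 = 1 := by
        rw [resR, sgnBit, if_pos]
        have e : (((a + 1 : ℕ) : ℝ) / n - M) = 1 / n := by
          rw [← h1]; push_cast; field_simp; ring
        rw [e]
        have h2 : (1 / n : ℝ) ^ 2 ≤ 1 / 4 := by
          rw [div_pow, div_le_div_iff₀ (by positivity) (by norm_num)]; nlinarith
        push_cast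
        simp only [zero_div, add_zero]
        nlinarith
      rw [this]; decide
    · rw [if_neg h1, zero_add]
      by_cases h2 : a + 1 = n * M + n
      · rw [if_pos h2]
        have : resR n M r₀ (a + 1) 0 = 0 := by
          rw [resR, sgnBit, if_neg]
          have e : (((a + 1 : ℕ) : ℝ) / n - M) = 1 := by
            rw [h2]; push_cast; field_simp; ring
          rw [e]
          push_cast
          simp only [zero_div, add_zero]
          nlinarith
        rw [this]; decide
      · rw [if_neg h2, zero_mul]
  rw [Finset.sum_congr rfl fun a _ => e a]
  rw [Finset.sum_eq_single_of_mem (n * M + n - 1), if_pos (by omega)]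
  · rw [Finset.mem_range]; nlinarith [Nat.sub_lt (by omega : 0 < n * M + n) one_pos]
  · intro b _ hb; rw [if_neg (by omega)]

theorem sum_initial_face (hX : ∀ p, p 0 = 0 → X p = rotXY (p 6) (hopfPoly (pairFst p)))
    (hY : ∀ p, p 0 = 0 → Y p = rotXY (p 6) (hopfPoly (pairSnd p)))
    (hn : 2 ≤ n) (hM : 1 ≤ M) (hr : 0 < r₀) (hr' : r₀ < 1 / 2) :
    ∑ w ∈ (latBox (latSize n M)).filter (fun w => w 0 = 0),
      cupW (oppV X Y n M r₀) (signL X Y n M r₀) (univ.erase 0) w = 1 := by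
  have hpos : 0 < n * M := by positivity
  have hlt : n * M < 2 * M * n := by nlinarith
  rw [← sum_initialTerm hn hM hr hr', ← Finset.sum_product']
  symm
  refine Finset.sum_of_injOn
    (fun ab : ℕ × ℕ => ![0, n * M - 1, ab.1, n * M - 1, n * M - 1, ab.2, n - 1]) ?_ ?_ ?_ ?_
  · rintro ⟨a, b⟩ _ ⟨a', b'⟩ _ h
    have h2 := congrFun h 2
    have h5 := congrFun h 5
    simp only [Matrix.cons_val] at h2 h5
    rw [h2, h5]
  · rintro ⟨a, b⟩ hab
    simp only [Finset.coe_product, Set.mem_prod, Finset.coe_range, Set.mem_Iio] at hab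
    simp only [Finset.coe_filter, Set.mem_ofPred_eq, latBox, Fintype.mem_piFinset,
      Finset.mem_range, Fin.forall_fin_succ, latSize]
    simp
    omega
  · intro w hw hne
    simp only [Finset.mem_filter, latBox, Fintype.mem_piFinset, Finset.mem_range] at hw
    rw [cupW_initial hX hY hn hr hw.2 (hw.1 6), if_neg]
    rintro ⟨h6, h4, h3, h1⟩
    refine hne ⟨(w 2, w 5), ?_, ?_⟩
    · simp only [Finset.coe_product, Set.mem_prod, Finset.coe_range, Set.mem_Iio]
      exact ⟨hw.1 2, hw.1 5⟩
    · funext i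
      fin_cases i <;> simp <;> omega
  · rintro ⟨a, b⟩ _
    rw [cupW_initial hX hY hn hr (by simp) (by simp; omega), if_pos]
    · rfl
    · simp; omega

end InitialFace

section Obstruction

open Finset

/-- The box of parameters of pairs. -/
def pairBox (M : ℕ) : Set (Fin 7 → ℝ) :=
  Set.Icc ![0, -M, -M, -M, -M, 0, 0] ![1, M, M, M, M, 2 * M + 1, Real.pi]

variable {X Y : (Fin 7 → ℝ) → Fin 4 → ℝ} {n M : ℕ} {r₀ : ℝ}

theorem latPar_mem_pairBox (hn : 0 < n) (hr : 0 < r₀) (hr1 : r₀ ≤ 1) {v : Fin 7 → ℕ}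
    (hv : ∀ i, v i ≤ latSize n M i) : latPar n M r₀ v ∈ pairBox M := by
  have hn' : (0:ℝ) < n := by exact_mod_cast hn
  have hpi := Real.pi_pos
  have h0 := hv 0
  have h1 := hv 1
  have h2 := hv 2
  have h3 := hv 3
  have h4 := hv 4
  have h5 := hv 5
  have h6 := hv 6
  simp only [latSize, Matrix.cons_val] at h0 h1 h2 h3 h4 h5 h6
  have e : ∀ a : ℕ, a ≤ 2 * M * n → (a : ℝ) / n ≤ 2 * M := by
    intro a ha
    rw [div_le_iff₀ hn']; exact_mod_cast ha
  have e' : ∀ a : ℕ, 0 ≤ (a : ℝ) / n := fun a => by positivity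
  constructor <;> intro i <;> fin_cases i <;> simp [latPar]
  · exact e' _
  · exact e' _
  · exact e' _
  · exact e' _
  · exact e' _
  · have := e' (v 5); linarith
  · positivity
  · rw [div_le_one hn']; exact_mod_cast h0
  · linarith [e _ h1]
  · linarith [e _ h2]
  · linarith [e _ h3]
  · linarith [e _ h4]
  · linarith [e _ h5]
  · have : (v 6 : ℝ) ≤ 2 * n := by exact_mod_cast h6
    rw [div_le_iff₀ (by positivity)]; nlinarith

theorem dist_latPar_lt (hn : 0 < n) {δ : ℝ} (hδ : 0 < δ) (hnδ : 4 / δ < n) {J : Finset (Fin 7)}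
    {v p q : Fin 7 → ℕ} (hp : p ∈ cubeV J v) (hq : q ∈ cubeV J v) :
    dist (latPar n M r₀ p) (latPar n M r₀ q) < δ := by
  have hn' : (0:ℝ) < n := by exact_mod_cast hn
  have hpi := Real.pi_pos
  have hpi4 := Real.pi_le_four
  have key : ∀ i, |(p i : ℝ) - q i| ≤ 1 := by
    intro i
    have h1 : (p i : ℝ) ≤ q i + 1 := by exact_mod_cast (by have := hp i; have := hq i; omega)
    have h2 : (q i : ℝ) ≤ p i + 1 := by exact_mod_cast (by have := hp i; have := hq i; omega)
    rw [abs_le]; constructor <;> linarith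
  have hd : 4 < n * δ := by rwa [div_lt_iff₀ hδ] at hnδ
  have e : ∀ i, |(p i : ℝ) / n - q i / n| < δ := by
    intro i
    rw [← sub_div, abs_div, abs_of_pos hn', div_lt_iff₀ hn']
    linarith [key i]
  rw [dist_pi_lt_iff hδ]
  intro i
  rw [Real.dist_eq]
  fin_cases i <;> simp [latPar]
  · exact e 0
  · exact e 1
  · exact e 2
  · exact e 3
  · exact e 4
  · exact e 5
  · rw [← sub_div, ← mul_sub, abs_div, abs_mul, abs_of_pos hpi,
      abs_of_pos (by positivity : (0:ℝ) < 2 * n),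
      div_lt_iff₀ (by positivity)]
    nlinarith [key 6]

theorem signV_spec (hn : 0 < n)
    (hsymX : ∀ p, p 6 = 0 → X (Function.update p 6 Real.pi) = ![-Y p 0, -Y p 1, Y p 2, Y p 3])
    (hsymY : ∀ p, p 6 = 0 → Y (Function.update p 6 Real.pi) = ![-X p 0, -X p 1, X p 2, X p 3])
    (k : Fin 6) (v : Fin 7 → ℕ) :
    (signV X Y n M r₀ k v = 1 → 0 ≤ pairForms (X (latPar n M r₀ v)) (Y (latPar n M r₀ v)) k) ∧
    (signV X Y n M r₀ k v = 0 → pairForms (X (latPar n M r₀ v)) (Y (latPar n M r₀ v)) k ≤ 0) := by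
  have hn' : (0:ℝ) < n := by exact_mod_cast hn
  have h1 : ∀ x : ℝ, (sgnBit x = 1 → 0 ≤ x) ∧ (sgnBit x = 0 → x ≤ 0) := by
    intro x
    rw [sgnBit]
    by_cases h : 0 ≤ x
    · simp [h]
    · simp [h, le_of_not_ge h]
  have h2 : ∀ x : ℝ, (1 + sgnBit x = 1 → x ≤ 0) ∧ (1 + sgnBit x = 0 → 0 ≤ x) := by
    intro x
    rw [sgnBit]
    by_cases h : 0 ≤ x
    · simp [h]
    · simp [h, le_of_not_ge h]
  by_cases h : v 6 = 2 * n
  · set w := latPar n M r₀ (Function.update v 6 0) with hw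
    have hw6 : w 6 = 0 := by simp [hw, latPar]
    have hv : latPar n M r₀ v = Function.update w 6 Real.pi := by
      funext i
      fin_cases i <;> simp [hw, latPar]
      rw [h]; push_cast; field_simp
    rw [signV, if_pos h, ← hw, hv, hsymX w hw6, hsymY w hw6]
    fin_cases k <;> simp only [flipBit, pairForms, Matrix.cons_val, Fin.zero_eta, Fin.mk_one,
      Fin.reduceFinMk]
    · obtain ⟨a, b⟩ := h2 (Y w 3 - X w 3)
      exact ⟨fun h => by linarith [a h], fun h => by linarith [b h]⟩
    · obtain ⟨a, b⟩ := h1 (X w 3 + Y w 3)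
      exact ⟨fun h => by linarith [a (by simpa using h)], fun h => by linarith [b (by simpa using h)]⟩
    · obtain ⟨a, b⟩ := h2 (Y w 2 - X w 2)
      exact ⟨fun h => by linarith [a h], fun h => by linarith [b h]⟩
    · obtain ⟨a, b⟩ := h1 (X w 1 - Y w 1)
      exact ⟨fun h => by linarith [a (by simpa using h)], fun h => by linarith [b (by simpa using h)]⟩
    · obtain ⟨a, b⟩ := h2 (X w 1 + Y w 1)
      exact ⟨fun h => by linarith [a h], fun h => by linarith [b h]⟩
    · obtain ⟨a, b⟩ := h1 (X w 2 + Y w 2)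
      exact ⟨fun h => by linarith [a (by simpa using h)], fun h => by linarith [b (by simpa using h)]⟩
  · rw [signV, if_neg h]
    exact h1 _

theorem abs_pairForms_sub_le {x y x' y' : Fin 4 → ℝ} {η : ℝ} (hx : ∀ i, |x i - x' i| ≤ η)
    (hy : ∀ i, |y i - y' i| ≤ η) (k : Fin 6) :
    |pairForms x y k - pairForms x' y' k| ≤ 2 * η := by
  simp only [abs_le] at hx hy ⊢
  fin_cases k <;> simp only [pairForms, Matrix.cons_val, Fin.zero_eta, Fin.mk_one,
      Fin.reduceFinMk]
  · have := hx 3; have := hy 3; constructor <;> linarith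
  · have := hx 3; have := hy 3; constructor <;> linarith
  · have := hx 2; have := hy 2; constructor <;> linarith
  · have := hx 1; have := hy 1; constructor <;> linarith
  · have := hx 1; have := hy 1; constructor <;> linarith
  · have := hx 2; have := hy 2; constructor <;> linarith

theorem abs_le_of_abs_pairForms_le {x y : Fin 4 → ℝ} {η : ℝ} (h : ∀ k, |pairForms x y k| ≤ η) :
    ∀ i, i ≠ 0 → |x i| ≤ η ∧ |y i| ≤ η := by
  have h0 := h 0
  have h1 := h 1
  have h2 := h 2
  have h3 := h 3
  have h4 := h 4
  have h5 := h 5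
  simp only [pairForms, Matrix.cons_val, abs_le] at h0 h1 h2 h3 h4 h5
  intro i hi
  fin_cases i
  · exact absurd rfl hi
  all_goals simp only [abs_le, Fin.mk_one, Fin.reduceFinMk]; constructor <;> constructor <;> linarith

/-- If all the functions `signV` vary on a cube, the corresponding forms are small there. -/
theorem abs_le_of_signV_ne (hn : 0 < n)
    (hsymX : ∀ p, p 6 = 0 → X (Function.update p 6 Real.pi) = ![-Y p 0, -Y p 1, Y p 2, Y p 3])
    (hsymY : ∀ p, p 6 = 0 → Y (Function.update p 6 Real.pi) = ![-X p 0, -X p 1, X p 2, X p 3])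
    {J : Finset (Fin 7)} {v : Fin 7 → ℕ} {η : ℝ}
    (hη : ∀ p ∈ cubeV J v, ∀ q ∈ cubeV J v, ∀ i,
      |X (latPar n M r₀ p) i - X (latPar n M r₀ q) i| ≤ η ∧
      |Y (latPar n M r₀ p) i - Y (latPar n M r₀ q) i| ≤ η)
    (h : ∀ s ∈ signL X Y n M r₀, ∃ p ∈ cubeV J v, ∃ q ∈ cubeV J v, s p ≠ s q)
    {z : Fin 7 → ℕ} (hz : z ∈ cubeV J v) (i : Fin 4) (hi : i ≠ 0) :
    |X (latPar n M r₀ z) i| ≤ 2 * η ∧ |Y (latPar n M r₀ z) i| ≤ 2 * η := by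
  refine abs_le_of_abs_pairForms_le (fun k => ?_) i hi
  have hk : signV X Y n M r₀ k ∈ signL X Y n M r₀ := by
    fin_cases k <;> simp [signL]
  obtain ⟨p, hp, q, hq, hpq⟩ := h _ hk
  have aux : ∀ p ∈ cubeV J v, ∀ q ∈ cubeV J v, signV X Y n M r₀ k p = 1 →
      signV X Y n M r₀ k q = 0 →
      |pairForms (X (latPar n M r₀ z)) (Y (latPar n M r₀ z)) k| ≤ 2 * η := by
    intro p hp q hq h1 h0
    have a := (signV_spec hn hsymX hsymY k p).1 h1
    have b := (signV_spec hn hsymX hsymY k q).2 h0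
    have c := abs_pairForms_sub_le (fun i => (hη z hz p hp i).1) (fun i => (hη z hz p hp i).2) k
    have d := abs_pairForms_sub_le (fun i => (hη z hz q hq i).1) (fun i => (hη z hz q hq i).2) k
    rw [abs_le] at c d ⊢
    constructor <;> linarith
  have bits : ∀ a b : ZMod 2, a ≠ b → (a = 1 ∧ b = 0) ∨ (b = 1 ∧ a = 0) := by decide
  rcases bits _ _ hpq with ⟨h1, h0⟩ | ⟨h1, h0⟩
  · exact aux p hp q hq h1 h0
  · exact aux q hq p hp h1 h0

theorem oppV_ne_zero {v : Fin 7 → ℕ} (h : oppV X Y n M r₀ v ≠ 0) :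
    0 < Y (latPar n M r₀ v) 0 ∧ X (latPar n M r₀ v) 0 < 0 := by
  by_contra h'
  exact h (if_neg h')

theorem sum_sq_lt {x : Fin 4 → ℝ} {η c₀ : ℝ} (hη : 16 * η ^ 2 < c₀)
    (h : ∀ i, |x i| ≤ 2 * η) : ∑ i, x i ^ 2 < c₀ + 0 := by
  have : ∀ i, x i ^ 2 ≤ (2 * η) ^ 2 := fun i => sq_le_sq' (abs_le.1 (h i)).1 (abs_le.1 (h i)).2
  calc ∑ i, x i ^ 2 ≤ ∑ _i : Fin 4, (2 * η) ^ 2 := Finset.sum_le_sum fun i _ => this i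
    _ = 16 * η ^ 2 := by simp; ring
    _ < c₀ + 0 := by linarith

/-- A family of pairs starting at the polynomial model cannot end at a constant one, if
the values do not vanish and the last coordinates are not small near the boundary. -/
theorem no_deformation_of_pairs (hXc : Continuous X) (hYc : Continuous Y) (hM : 1 ≤ M) {c₀ : ℝ}
    (hc₀ : 0 < c₀)
    (hnz : ∀ p ∈ pairBox M, c₀ ≤ ∑ i, X p i ^ 2 ∧ c₀ ≤ ∑ i, Y p i ^ 2)
    (hout : ∀ p ∈ pairBox M, (∃ i : Fin 7, i ≠ 0 ∧ i ≠ 5 ∧ i ≠ 6 ∧ |p i| = M) ∨ 2 * M ≤ p 5 →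
      c₀ ≤ X p 2 ^ 2 + X p 3 ^ 2 ∨ c₀ ≤ Y p 2 ^ 2 + Y p 3 ^ 2)
    (heq : ∀ p, p 5 = 0 → X p = Y p)
    (hsymX : ∀ p, p 6 = 0 → X (Function.update p 6 Real.pi) = ![-Y p 0, -Y p 1, Y p 2, Y p 3])
    (hsymY : ∀ p, p 6 = 0 → Y (Function.update p 6 Real.pi) = ![-X p 0, -X p 1, X p 2, X p 3])
    (hend : ∀ p, p 0 = 1 → X p 2 = 1 ∧ Y p 2 = 1)
    (hX : ∀ p, p 0 = 0 → X p = rotXY (p 6) (hopfPoly (pairFst p)))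
    (hY : ∀ p, p 0 = 0 → Y p = rotXY (p 6) (hopfPoly (pairSnd p))) : False := by
  obtain ⟨η, hη0, hη1, hη⟩ : ∃ η : ℝ, 0 < η ∧ 2 * η < 1 ∧ 16 * η ^ 2 < c₀ := by
    refine ⟨min (1 / 4) (c₀ / 32), by positivity, ?_, ?_⟩
    · linarith [min_le_left (1 / 4) (c₀ / 32)]
    · have h1 := min_le_left (1 / 4) (c₀ / 32)
      have h2 := min_le_right (1 / 4) (c₀ / 32)
      have h3 : 0 < min (1 / 4) (c₀ / 32) := by positivity
      nlinarith
  have hcomp : IsCompact (pairBox M) := isCompact_Icc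
  obtain ⟨δ, hδ, hunif⟩ : ∃ δ > 0, ∀ p ∈ pairBox M, ∀ q ∈ pairBox M, dist p q < δ →
      ∀ i, |X p i - X q i| ≤ η ∧ |Y p i - Y q i| ≤ η := by
    have hu := hcomp.uniformContinuousOn_of_continuous
      ((hXc.prodMk hYc).continuousOn (s := pairBox M))
    obtain ⟨δ, hδ, h⟩ := Metric.uniformContinuousOn_iff.1 hu η hη0
    refine ⟨δ, hδ, fun p hp q hq hpq i => ?_⟩
    have h' := h p hp q hq hpq
    rw [Prod.dist_eq, max_lt_iff] at h'
    exact ⟨(dist_le_pi_dist (X p) (X q) i).trans h'.1.le,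
      (dist_le_pi_dist (Y p) (Y q) i).trans h'.2.le⟩
  obtain ⟨r₀, hr, hr2, hrδ⟩ : ∃ r : ℝ, 0 < r ∧ r < 1 / 2 ∧ r < δ := by
    refine ⟨min (1 / 4) (δ / 2), by positivity, ?_, ?_⟩
    · linarith [min_le_left (1 / 4) (δ / 2)]
    · linarith [min_le_right (1 / 4) (δ / 2)]
  obtain ⟨n, hnδ⟩ := exists_nat_gt (max 2 (4 / δ))
  have hn : 2 ≤ n := by
    have : (2:ℝ) < n := (le_max_left _ _).trans_lt hnδ
    exact_mod_cast this.le
  replace hnδ : 4 / δ < n := (le_max_right _ _).trans_lt hnδ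
  have hn0 : 0 < n := by omega
  have hn' : (0:ℝ) < n := by exact_mod_cast hn0
  set P := latPar n M r₀ with hP
  set N := latSize n M with hN
  have hNpos : ∀ i, 0 < N i := by
    intro i
    have : 0 < 2 * M * n := by positivity
    fin_cases i <;> simp [hN, latSize] <;> omega
  have hmem : ∀ v, (∀ i, v i ≤ N i) → P v ∈ pairBox M := fun v hv =>
    latPar_mem_pairBox hn0 hr (by linarith) hv
  have hvar : ∀ J : Finset (Fin 7), ∀ v, (∀ p ∈ cubeV J v, ∀ i, p i ≤ N i) →
      ∀ p ∈ cubeV J v, ∀ q ∈ cubeV J v, ∀ i, |X (P p) i - X (P q) i| ≤ η ∧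
        |Y (P p) i - Y (P q) i| ≤ η := fun J v hv p hp q hq =>
    hunif _ (hmem p (hv p hp)) _ (hmem q (hv q hq)) (dist_latPar_lt hn0 hδ hnδ hp hq)
  have hsmall : ∀ J : Finset (Fin 7), ∀ v, (∀ p ∈ cubeV J v, ∀ i, p i ≤ N i) →
      (∀ s ∈ signL X Y n M r₀, ∃ p ∈ cubeV J v, ∃ q ∈ cubeV J v, s p ≠ s q) →
      ∀ z ∈ cubeV J v, ∀ i, i ≠ 0 → |X (P z) i| ≤ 2 * η ∧ |Y (P z) i| ≤ 2 * η :=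
    fun J v hv h z hz i hi => abs_le_of_signV_ne hn0 hsymX hsymY (hvar J v hv) h hz i hi
  have hmix : ∀ x : Fin 4 → ℝ, |x 0| ≤ 2 * η → (∀ i, i ≠ 0 → |x i| ≤ 2 * η) →
      ¬ c₀ ≤ ∑ i, x i ^ 2 := by
    intro x h0 h1 h
    have := sum_sq_lt (x := x) hη fun i => by
      by_cases hi : i = 0
      · rw [hi]; exact h0
      · exact h1 i hi
    linarith
  have htwo : ∀ a b : ℝ, |a| ≤ 2 * η → |b| ≤ 2 * η → ¬ c₀ ≤ a ^ 2 + b ^ 2 := by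
    intro a b ha hb h
    have := sq_le_sq' (abs_le.1 ha).1 (abs_le.1 ha).2
    have := sq_le_sq' (abs_le.1 hb).1 (abs_le.1 hb).2
    nlinarith
  -- the cochain is closed
  have hclosed : ∀ v ∈ latBox N,
      cupW (fun _ => 1) (signL X Y n M r₀ ++ [oppV X Y n M r₀]) univ v = 0 := by
    intro v hv
    simp only [latBox, Fintype.mem_piFinset, Finset.mem_range] at hv
    by_contra hne
    have hcube : ∀ p ∈ cubeV univ v, ∀ i, p i ≤ N i := fun p hp i => by
      have := hp i; have := hv i; omega
    obtain ⟨h, -⟩ := exists_of_cupW_ne_zero _ _ _ _ hne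
    have hs := hsmall univ v hcube fun s hs => h s (List.mem_append_left _ hs)
    obtain ⟨p, hp, q, hq, hpq⟩ := h (oppV X Y n M r₀) (by simp)
    have aux : ∀ p ∈ cubeV univ v, ∀ q ∈ cubeV univ v, oppV X Y n M r₀ p ≠ 0 →
        ¬ oppV X Y n M r₀ q ≠ 0 → False := by
      intro p hp q hq hp0 hq0
      obtain ⟨h1, h2⟩ := oppV_ne_zero hp0
      have hq' : ¬ (0 < Y (P q) 0 ∧ X (P q) 0 < 0) := by
        intro h'
        apply hq0
        rw [oppV, if_pos h']
        decide
      have hb := hvar univ v hcube p hp q hq 0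
      rw [abs_le, abs_le] at hb
      have hnzp := hnz _ (hmem p (hcube p hp))
      rw [not_and_or, not_lt, not_lt] at hq'
      rcases hq' with h' | h'
      · refine hmix _ ?_ (fun i hi => (hs p hp i hi).2) hnzp.2
        rw [abs_le]; constructor <;> linarith [hb.2.1, hb.2.2]
      · refine hmix _ ?_ (fun i hi => (hs p hp i hi).1) hnzp.1
        rw [abs_le]; constructor <;> linarith [hb.1.1, hb.1.2]
    by_cases hp0 : oppV X Y n M r₀ p = 0
    · exact aux q hq p hp (fun h => hpq (hp0.trans h.symm)) (not_not.2 hp0)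
    · refine aux p hp q hq hp0 fun hq0 => hpq ?_
      have : ∀ a b : ZMod 2, a ≠ 0 → b ≠ 0 → a = b := by decide
      exact this _ _ hp0 hq0
  have hstokes := sum_faces_eq_zero _ _ N hNpos hclosed
  set W := cupW (oppV X Y n M r₀) (signL X Y n M r₀) with hW
  -- cubes contained in faces
  have hface : ∀ (j : Fin 7) (w : Fin 7 → ℕ), (∀ i, i ≠ j → w i < N i) → w j ≤ N j →
      W (univ.erase j) w ≠ 0 → (∀ z ∈ cubeV (univ.erase j) w, P z ∈ pairBox M ∧
        ∀ i, i ≠ 0 → |X (P z) i| ≤ 2 * η ∧ |Y (P z) i| ≤ 2 * η) ∧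
      ∃ p ∈ cubeV (univ.erase j) w, 0 < Y (P p) 0 ∧ X (P p) 0 < 0 := by
    intro j w hw hwj hne
    have hcube : ∀ p ∈ cubeV (univ.erase j) w, ∀ i, p i ≤ N i := fun p hp i => by
      by_cases hij : i = j
      · subst hij
        rw [(hp i).2.2 (Finset.notMem_erase _ _)]; exact hwj
      · have := hp i; have := hw i hij; omega
    obtain ⟨h, p, hp, hp0⟩ := exists_of_cupW_ne_zero _ _ _ _ hne
    exact ⟨fun z hz => ⟨hmem z (hcube z hz), hsmall _ w hcube h z hz⟩, p, hp, oppV_ne_zero hp0⟩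
  have hMface : ∀ (j : Fin 7) (w : Fin 7 → ℕ), (∀ i, i ≠ j → w i < N i) → w j ≤ N j →
      ((j ≠ 0 ∧ j ≠ 5 ∧ j ≠ 6 ∧ |P w j| = M) ∨ (j = 5 ∧ 2 * M ≤ P w 5)) →
      W (univ.erase j) w = 0 := by
    intro j w hw hwj hcase
    by_contra hne
    obtain ⟨h, -⟩ := hface j w hw hwj hne
    obtain ⟨hb, hs⟩ := h w (self_mem_cubeV _ _)
    rcases hout _ hb (hcase.imp (fun h => ⟨j, h⟩) (fun h => h.2)) with h' | h'
    · exact htwo _ _ (hs 2 (by decide)).1 (hs 3 (by decide)).1 h'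
    · exact htwo _ _ (hs 2 (by decide)).2 (hs 3 (by decide)).2 h'
  have hmidface : ∀ (j : Fin 7), j ≠ 0 → j ≠ 5 → j ≠ 6 → ∀ w ∈ (latBox N).filter (fun w => w j = 0),
      W (univ.erase j) w + W (univ.erase j) (Function.update w j (N j)) = 0 := by
    intro j h0 h5 h6 w hw
    simp only [Finset.mem_filter, latBox, Fintype.mem_piFinset, Finset.mem_range] at hw
    have e : ∀ v : Fin 7 → ℕ, P v j = v j / n - M := by
      intro v
      fin_cases j <;> first | exact absurd rfl h0 | exact absurd rfl h5 | exact absurd rfl h6 | rfl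
    have eN : N j = 2 * M * n := by
      fin_cases j <;> first | exact absurd rfl h0 | exact absurd rfl h5 | exact absurd rfl h6 | rfl
    rw [hMface j w (fun i _ => hw.1 i) (hw.1 j).le (Or.inl ⟨h0, h5, h6, ?_⟩),
      hMface j _ (fun i hi => by simpa [hi] using hw.1 i) (by simp) (Or.inl ⟨h0, h5, h6, ?_⟩),
      add_zero]
    rotate_left
    · rw [e, hw.2]; simp
    · rw [e, Function.update_self, eN]; push_cast
      rw [mul_div_cancel_right₀ _ hn'.ne', show (2 * M - M : ℝ) = M by ring]; simp
  have hrface : ∀ w ∈ (latBox N).filter (fun w => w 5 = 0),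
      W (univ.erase 5) w + W (univ.erase 5) (Function.update w 5 (N 5)) = 0 := by
    intro w hw
    simp only [Finset.mem_filter, latBox, Fintype.mem_piFinset, Finset.mem_range] at hw
    rw [hMface 5 (Function.update w 5 (N 5)) (fun i hi => by simpa [hi] using hw.1 i) (by simp)
      (Or.inr ⟨rfl, ?_⟩), add_zero]
    swap
    · simp only [hP, latPar, Matrix.cons_val, Function.update_self, hN, latSize]
      push_cast
      rw [mul_div_cancel_right₀ _ hn'.ne']; linarith
    by_contra hne
    obtain ⟨h, p, hp, h1, h2⟩ := hface 5 w (fun i _ => hw.1 i) (hw.1 5).le hne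
    obtain ⟨hb, hs⟩ := h p hp
    have hp5 : P p 5 = r₀ := by
      have : p 5 = 0 := by rw [(hp 5).2.2 (Finset.notMem_erase _ _), hw.2]
      simp [hP, latPar, this]
    have hb' : Function.update (P p) 5 0 ∈ pairBox M := by
      have hb2 := hb
      constructor <;> intro i <;> by_cases hi : i = 5
      · subst hi; simp
      · rw [Function.update_of_ne hi]; exact hb2.1 i
      · subst hi; simp; positivity
      · rw [Function.update_of_ne hi]; exact hb2.2 i
    have hd : dist (P p) (Function.update (P p) 5 0) < δ := by
      rw [dist_pi_lt_iff hδ]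
      intro i
      by_cases hi : i = 5
      · subst hi; simp [hp5, abs_of_pos hr, hrδ]
      · simpa [Function.update_of_ne hi] using hδ
    have hu := hunif _ hb _ hb' hd 0
    rw [heq (Function.update (P p) 5 0) (by simp)] at hu
    refine hmix _ ?_ (fun i hi => (hs i hi).2) (hnz _ hb).2
    rw [abs_le, abs_le] at hu
    rw [abs_le]; constructor <;> linarith [hu.1.1, hu.1.2, hu.2.1, hu.2.2]
  have hphiface : ∀ w ∈ (latBox N).filter (fun w => w 6 = 0),
      W (univ.erase 6) w + W (univ.erase 6) (Function.update w 6 (N 6)) = 0 := by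
    intro w hw
    simp only [Finset.mem_filter] at hw
    have hN6 : N 6 = 2 * n := rfl
    rw [hW, cupW_update_eq _ 6 (N 6) ?_ _ ?_ _ _ (Finset.notMem_erase _ _) hw.2,
      CharTwo.add_self_eq_zero]
    · intro v hv
      have hv6 : P v 6 = 0 := by simp [hP, latPar, hv]
      have e : P (Function.update v 6 (N 6)) = Function.update (P v) 6 Real.pi := by
        funext i
        fin_cases i <;> simp [hP, latPar, hN6]
        field_simp
      rw [oppV, oppV, ← hP, e, hsymX _ hv6, hsymY _ hv6]
      congr 1
      simp [and_comm]
    · have key : ∀ k, ∀ v : Fin 7 → ℕ, v 6 = 0 →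
          signV X Y n M r₀ k (Function.update v 6 (N 6)) = flipBit k + signV X Y n M r₀ k v := by
        intro k v hv
        rw [signV, if_pos (by simp [hN6]), signV, if_neg (by omega), Function.update_idem,
          ← hv, Function.update_eq_self]
      intro s hs
      simp only [signL, List.mem_cons, List.not_mem_nil, or_false] at hs
      rcases hs with rfl | rfl | rfl | rfl | rfl | rfl <;> exact ⟨_, key _⟩
  have hend0 : ∀ w ∈ (latBox N).filter (fun w => w 0 = 0),
      W (univ.erase 0) w + W (univ.erase 0) (Function.update w 0 (N 0)) = W (univ.erase 0) w := by
    intro w hw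
    simp only [Finset.mem_filter, latBox, Fintype.mem_piFinset, Finset.mem_range] at hw
    rw [add_eq_left]
    by_contra hne
    obtain ⟨h, -⟩ := hface 0 (Function.update w 0 (N 0)) (fun i hi => by simpa [hi] using hw.1 i)
      (by simp) hne
    have hs := (h _ (self_mem_cubeV _ _)).2 2 (by decide)
    have e : P (Function.update w 0 (N 0)) 0 = 1 := by
      simp only [hP, latPar, Matrix.cons_val, Function.update_self, hN, latSize]
      exact div_self hn'.ne'
    rw [(hend _ e).1] at hs
    have := hs.1
    rw [abs_one] at this
    linarith
  have hinit := sum_initial_face hX hY hn hM hr hr2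
  rw [Fin.sum_univ_seven, Finset.sum_congr rfl hend0, hinit,
    Finset.sum_eq_zero (hmidface 1 (by decide) (by decide) (by decide)),
    Finset.sum_eq_zero (hmidface 2 (by decide) (by decide) (by decide)),
    Finset.sum_eq_zero (hmidface 3 (by decide) (by decide) (by decide)),
    Finset.sum_eq_zero (hmidface 4 (by decide) (by decide) (by decide)),
    Finset.sum_eq_zero hrface, Finset.sum_eq_zero hphiface] at hstokes
  simp at hstokes

end Obstruction

section AdmissibleMaps

theorem continuous_rotXY {α : Type*} [TopologicalSpace α] {φ : α → ℝ} {w : α → Fin 4 → ℝ}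
    (hφ : Continuous φ) (hw : Continuous w) : Continuous fun a => rotXY (φ a) (w a) := by
  have h : ∀ i, Continuous fun a => w a i := fun i => (continuous_apply i).comp hw
  refine continuous_pi fun i => ?_
  have h0 := h 0
  have h1 := h 1
  have h2 := h 2
  have h3 := h 3
  fin_cases i <;> simp only [rotXY, Matrix.cons_val, Fin.zero_eta, Fin.mk_one,
      Fin.reduceFinMk] <;> fun_prop

theorem continuous_pairFst : Continuous pairFst := by
  refine continuous_pi fun i => ?_
  fin_cases i <;> simp only [pairFst, Matrix.cons_val, Fin.zero_eta, Fin.mk_one,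
      Fin.reduceFinMk] <;> fun_prop

theorem continuous_pairSnd : Continuous pairSnd := by
  refine continuous_pi fun i => ?_
  fin_cases i <;> simp only [pairSnd, Matrix.cons_val, Fin.zero_eta, Fin.mk_one,
      Fin.reduceFinMk] <;> fun_prop

theorem sum_rotXY_sq (φ : ℝ) (w : Fin 4 → ℝ) : ∑ i, rotXY φ w i ^ 2 = ∑ i, w i ^ 2 := by
  simp only [Fin.sum_univ_four, rotXY, Matrix.cons_val]
  linear_combination (w 0 ^ 2 + w 1 ^ 2) * Real.sin_sq_add_cos_sq φ

theorem not_admissible_deformation {f : ℝ × EucA 4 → EucA 4} (hf : Continuous f) {ρ : ℝ}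
    (hnz : ∀ q, f q ≠ 0) (hout : ∀ t x, ρ ≤ ‖x‖ → f (t, x) 2 ≠ 0 ∨ f (t, x) 3 ≠ 0)
    (h0 : ∀ x : EucA 4, f (0, x) = WithLp.toLp 2 (hopfPoly x))
    (h1 : ∀ x, f (1, x) 2 = 1) : False := by
  obtain ⟨M, hM⟩ := exists_nat_ge (max ρ 1)
  have hM1 : 1 ≤ M := by exact_mod_cast (le_max_right _ _).trans hM
  have hMρ : ρ ≤ M := (le_max_left _ _).trans hM
  set x : (Fin 7 → ℝ) → EucA 4 := fun p => WithLp.toLp 2 (pairFst p) with hx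
  set y : (Fin 7 → ℝ) → EucA 4 := fun p => WithLp.toLp 2 (pairSnd p) with hy
  have hxc : Continuous x := (PiLp.continuous_toLp 2 _).comp continuous_pairFst
  have hyc : Continuous y := (PiLp.continuous_toLp 2 _).comp continuous_pairSnd
  set X : (Fin 7 → ℝ) → Fin 4 → ℝ := fun p => rotXY (p 6) (f (p 0, x p)) with hX
  set Y : (Fin 7 → ℝ) → Fin 4 → ℝ := fun p => rotXY (p 6) (f (p 0, y p)) with hY
  have hXc : Continuous X := continuous_rotXY (continuous_apply 6)
    ((PiLp.continuous_ofLp 2 _).comp (hf.comp ((continuous_apply 0).prodMk hxc)))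
  have hYc : Continuous Y := continuous_rotXY (continuous_apply 6)
    ((PiLp.continuous_ofLp 2 _).comp (hf.comp ((continuous_apply 0).prodMk hyc)))
  have hcomp : IsCompact (pairBox M) := isCompact_Icc
  have hpos : ∀ q, 0 < ∑ i, f q i ^ 2 := by
    intro q
    rw [← EuclideanSpace.real_norm_sq_eq]
    have := norm_pos_iff.2 (hnz q)
    positivity
  have hX2 : Continuous fun p => ∑ i, X p i ^ 2 :=
    continuous_finsetSum _ fun i _ => ((continuous_apply i).comp hXc).pow 2
  have hY2 : Continuous fun p => ∑ i, Y p i ^ 2 :=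
    continuous_finsetSum _ fun i _ => ((continuous_apply i).comp hYc).pow 2
  have hX3 : Continuous fun p => X p 2 ^ 2 + X p 3 ^ 2 :=
    (((continuous_apply 2).comp hXc).pow 2).add (((continuous_apply 3).comp hXc).pow 2)
  have hY3 : Continuous fun p => Y p 2 ^ 2 + Y p 3 ^ 2 :=
    (((continuous_apply 2).comp hYc).pow 2).add (((continuous_apply 3).comp hYc).pow 2)
  obtain ⟨a1, ha1, hb1⟩ := hcomp.exists_forall_le' hX2.continuousOn (a := 0)
    fun p _ => by simp only [hX, sum_rotXY_sq]; exact hpos _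
  obtain ⟨a2, ha2, hb2⟩ := hcomp.exists_forall_le' hY2.continuousOn (a := 0)
    fun p _ => by simp only [hY, sum_rotXY_sq]; exact hpos _
  have hp2 : ∀ a b : ℝ, a ≠ 0 ∨ b ≠ 0 → 0 < a ^ 2 + b ^ 2 := by
    rintro a b (h | h) <;> positivity
  obtain ⟨a3, ha3, hb3⟩ := (hcomp.inter_right
    (isClosed_le (continuous_const (y := ρ)) hxc.norm)).exists_forall_le' hX3.continuousOn (a := 0)
    fun p hp => hp2 _ _ (hout _ _ hp.2)
  obtain ⟨a4, ha4, hb4⟩ := (hcomp.inter_right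
    (isClosed_le (continuous_const (y := ρ)) hyc.norm)).exists_forall_le' hY3.continuousOn (a := 0)
    fun p hp => hp2 _ _ (hout _ _ hp.2)
  refine no_deformation_of_pairs hXc hYc hM1 (c₀ := min (min a1 a2) (min a3 a4)) (by positivity)
    ?_ ?_ ?_ ?_ ?_ ?_ ?_ ?_
  · intro p hp
    exact ⟨((min_le_left _ _).trans (min_le_left _ _)).trans (hb1 p hp),
      ((min_le_left _ _).trans (min_le_right _ _)).trans (hb2 p hp)⟩
  · intro p hp hcase
    have hsum : (M : ℝ) ^ 2 ≤ p 1 ^ 2 + p 2 ^ 2 + p 3 ^ 2 + p 4 ^ 2 + p 5 ^ 2 / 4 := by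
      rcases hcase with ⟨i, hi0, hi5, hi6, hi⟩ | h
      · rw [← hi, sq_abs]
        fin_cases i <;> simp only [Fin.zero_eta, Fin.mk_one, Fin.reduceFinMk] at * <;>
          first | exact absurd rfl hi0 | exact absurd rfl hi5 | exact absurd rfl hi6 |
            nlinarith [sq_nonneg (p 1), sq_nonneg (p 2), sq_nonneg (p 3), sq_nonneg (p 4),
              sq_nonneg (p 5)]
      · have : (0:ℝ) ≤ M := by positivity
        nlinarith [sq_nonneg (p 1), sq_nonneg (p 2), sq_nonneg (p 3), sq_nonneg (p 4)]
    have hn : ‖x p‖ ^ 2 + ‖y p‖ ^ 2 =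
        2 * (p 1 ^ 2 + p 2 ^ 2 + p 3 ^ 2 + p 4 ^ 2 + p 5 ^ 2 / 4) := by
      rw [EuclideanSpace.real_norm_sq_eq, EuclideanSpace.real_norm_sq_eq]
      simp only [hx, hy, Fin.sum_univ_four, pairFst, pairSnd, Matrix.cons_val]
      linear_combination (p 5 ^ 2 / 2) * Real.sin_sq_add_cos_sq (p 6)
    by_cases hxρ : (M : ℝ) ≤ ‖x p‖
    · left
      exact ((min_le_right _ _).trans (min_le_left _ _)).trans (hb3 p ⟨hp, hMρ.trans hxρ⟩)
    · right
      refine ((min_le_right _ _).trans (min_le_right _ _)).trans (hb4 p ⟨hp, hMρ.trans ?_⟩)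
      by_contra hyρ
      push Not at hxρ hyρ
      have := norm_nonneg (x p)
      have := norm_nonneg (y p)
      nlinarith
  · intro p hp
    have : x p = y p := by simp only [hx, hy, pairFst, pairSnd, hp]; simp
    simp only [hX, hY, this]
  · intro p hp
    have : x (Function.update p 6 Real.pi) = y p := by
      simp only [hx, hy, pairFst, pairSnd, hp]; simp [sub_eq_add_neg]
    simp only [hX, hY, this, hp]
    simp [rotXY]
  · intro p hp
    have : y (Function.update p 6 Real.pi) = x p := by
      simp only [hx, hy, pairFst, pairSnd, hp]; simp [sub_eq_add_neg]
    simp only [hX, hY, this, hp]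
    simp [rotXY]
  · intro p hp
    simp only [hX, hY, hp, rotXY, Matrix.cons_val]
    exact ⟨h1 _, h1 _⟩
  · intro p hp
    simp only [hX, hp, h0, hx]
  · intro p hp
    simp only [hY, hp, h0, hy]

/-- Nowhere vanishing maps of `ℝ⁴` which far out avoid a plane. -/
def Admissible (ρ : ℝ) (f : EucA 4 → EucA 4) : Prop :=
  (∀ x, f x ≠ 0) ∧ ∀ x, ρ ≤ ‖x‖ → f x 2 ≠ 0 ∨ f x 3 ≠ 0

/-- Homotopy through admissible maps. -/
def AdmHomotopic (f g : C(EucA 4, EucA 4)) : Prop :=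
  ∃ ρ, ContinuousMap.HomotopicWith f g fun h => Admissible ρ h

theorem Admissible.mono {ρ ρ' : ℝ} (h : ρ ≤ ρ') {f : EucA 4 → EucA 4} (hf : Admissible ρ f) :
    Admissible ρ' f := ⟨hf.1, fun x hx => hf.2 x (h.trans hx)⟩

theorem AdmHomotopic.trans {f g h : C(EucA 4, EucA 4)} (h1 : AdmHomotopic f g)
    (h2 : AdmHomotopic g h) : AdmHomotopic f h := by
  obtain ⟨ρ₁, ⟨F⟩⟩ := h1
  obtain ⟨ρ₂, ⟨G⟩⟩ := h2
  refine ⟨max ρ₁ ρ₂, ContinuousMap.HomotopicWith.trans (g := g)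
    ⟨⟨F.toHomotopy, fun t => (F.prop' t).mono (le_max_left _ _)⟩⟩
    ⟨⟨G.toHomotopy, fun t => (G.prop' t).mono (le_max_right _ _)⟩⟩⟩

theorem AdmHomotopic.symm {f g : C(EucA 4, EucA 4)} (h : AdmHomotopic f g) :
    AdmHomotopic g f := by
  obtain ⟨ρ, h⟩ := h
  exact ⟨ρ, h.symm⟩

theorem admHomotopic_of_continuousOn {f g : C(EucA 4, EucA 4)} (H : ℝ → EucA 4 → EucA 4)
    (hH : ContinuousOn (fun q : ℝ × EucA 4 => H q.1 q.2) (Icc (0:ℝ) 1 ×ˢ univ)) {ρ : ℝ}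
    (hadm : ∀ t ∈ Icc (0:ℝ) 1, Admissible ρ (H t)) (h0 : ∀ x, H 0 x = f x)
    (h1 : ∀ x, H 1 x = g x) : AdmHomotopic f g := by
  refine ⟨ρ, ⟨⟨⟨⟨fun q => H q.1 q.2, ?_⟩, ?_, ?_⟩, ?_⟩⟩⟩
  · exact hH.comp_continuous (f := fun q : unitInterval × EucA 4 => ((q.1 : ℝ), q.2))
      (by fun_prop) fun q => ⟨q.1.2, mem_univ _⟩
  · exact h0
  · exact h1
  · exact fun t => hadm t t.2

theorem continuous_hopfPoly : Continuous hopfPoly := by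
  refine continuous_pi fun i => ?_
  fin_cases i <;> simp only [hopfPoly, Matrix.cons_val, Fin.zero_eta, Fin.mk_one,
      Fin.reduceFinMk] <;> fun_prop

/-- The polynomial model as a continuous map. -/
def hopfPolyC : C(EucA 4, EucA 4) :=
  ⟨fun x => WithLp.toLp 2 (hopfPoly x), (PiLp.continuous_toLp 2 _).comp
    (continuous_hopfPoly.comp (PiLp.continuous_ofLp 2 _))⟩

/-- The base point of `S³`. -/
def e3pt : EucA 4 := !₂[0, 0, 1, 0]

theorem not_admHomotopic_const : ¬ AdmHomotopic hopfPolyC (ContinuousMap.const _ e3pt) := by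
  rintro ⟨ρ, ⟨F⟩⟩
  refine not_admissible_deformation
    (f := fun q => F (projIcc 0 1 zero_le_one q.1, q.2)) (ρ := ρ) ?_ ?_ ?_ ?_ ?_
  · exact F.continuous.comp ((continuous_projIcc.comp continuous_fst).prodMk continuous_snd)
  · exact fun q => (F.prop' _).1 _
  · exact fun t x hx => (F.prop' _).2 x hx
  · intro x
    have : projIcc (0:ℝ) 1 zero_le_one 0 = 0 := projIcc_left _
    simp only [this]
    exact F.apply_zero x
  · intro x
    have : projIcc (0:ℝ) 1 zero_le_one 1 = 1 := projIcc_right _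
    simp only [this]
    rw [show F (1, x) = e3pt from F.apply_one x]
    simp [e3pt]

end AdmissibleMaps

section Model

/-- A radial cutoff equal to `1` at the origin. -/
def radCut (x : EucA 3) : ℝ := Real.smoothTransition (1 - 10 * (x 0 ^ 2 + x 1 ^ 2 + x 2 ^ 2))

/-- Unnormalized collapsing map `ℝ³ → ℝ⁴ ∖ 0`. -/
def rawCollapse (x : EucA 3) : EucA 4 :=
  !₂[radCut x * x 0, radCut x * x 1, 1 - 2 * radCut x, radCut x * x 2]

/-- A smooth map `ℝ³ → S³` of degree one, constant outside of a ball. -/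
def collapse (x : EucA 3) : EucA 4 := ‖rawCollapse x‖⁻¹ • rawCollapse x

/-- The first factor of the model map: a polynomial map with the Hopf link as framed fibre. -/
def hopfPart (u : EucA 4) : EucA 3 :=
  !₂[2 * u 0 * u 2 - u 1 * (u 0 ^ 2 + u 1 ^ 2 - 1), u 0 * (u 0 ^ 2 + u 1 ^ 2 - 1) + 2 * u 1 * u 2,
    u 3]

/-- Squared distance (up to comparison) to the unit circle. -/
def circDist (u : EucA 4) : ℝ := 4 * u 2 ^ 2 + (u 0 ^ 2 + u 1 ^ 2 - 1) ^ 2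

open Classical in
/-- The model map `ℝ⁴ → S³`, constant outside of a box. -/
def modelMap (u : EucA 4) : EucA 4 := if circDist u < 1 / 2 then collapse (hopfPart u) else e3pt

/-- The box outside of which `modelMap` is constant. -/
def modelBox : Set (EucA 4) :=
  {u | |u 0| ≤ Real.pi / 2 ∧ |u 1| ≤ Real.pi / 2 ∧ |u 2| ≤ Real.pi / 2 ∧ |u 3| ≤ 7 / 20}

theorem contDiff_radCut : ContDiff ℝ 1 radCut := by
  unfold radCut
  exact Real.smoothTransition.contDiff.comp (by fun_prop)

theorem rawCollapse_ne_zero (x : EucA 3) : rawCollapse x ≠ 0 := by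
  intro h
  have h0 : radCut x * x 0 = 0 := congrArg (fun v : EucA 4 => v 0) h
  have h1 : radCut x * x 1 = 0 := congrArg (fun v : EucA 4 => v 1) h
  have h2 : 1 - 2 * radCut x = 0 := congrArg (fun v : EucA 4 => v 2) h
  have h3 : radCut x * x 2 = 0 := congrArg (fun v : EucA 4 => v 3) h
  have hb : radCut x = 1 / 2 := by linarith
  have hb0 : radCut x ≠ 0 := by rw [hb]; norm_num
  have z0 := (mul_eq_zero.1 h0).resolve_left hb0
  have z1 := (mul_eq_zero.1 h1).resolve_left hb0
  have z2 := (mul_eq_zero.1 h3).resolve_left hb0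
  rw [radCut, z0, z1, z2] at hb
  norm_num at hb

theorem contDiff_rawCollapse : ContDiff ℝ 1 rawCollapse := by
  rw [contDiff_euclidean]
  have := contDiff_radCut
  intro i
  fin_cases i <;> simp only [rawCollapse, Matrix.cons_val, Fin.zero_eta, Fin.mk_one,
      Fin.reduceFinMk] <;> fun_prop

theorem contDiff_collapse : ContDiff ℝ 1 collapse :=
  ((contDiff_rawCollapse.norm ℝ rawCollapse_ne_zero).inv
    fun x => norm_ne_zero_iff.2 (rawCollapse_ne_zero x)).smul contDiff_rawCollapse

theorem norm_collapse (x : EucA 3) : ‖collapse x‖ = 1 := by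
  rw [collapse, norm_smul, norm_inv, norm_norm,
    inv_mul_cancel₀ (norm_ne_zero_iff.2 (rawCollapse_ne_zero x))]

theorem norm_e3pt : ‖e3pt‖ = 1 := by
  simp [EuclideanSpace.norm_eq, e3pt, Fin.sum_univ_four]

theorem collapse_eq_e3pt {x : EucA 3} (h : radCut x = 0) : collapse x = e3pt := by
  have : rawCollapse x = e3pt := by simp [rawCollapse, h, e3pt]
  rw [collapse, this, norm_e3pt]; simp

theorem radCut_eq_zero {x : EucA 3} (h : 1 / 10 ≤ x 0 ^ 2 + x 1 ^ 2 + x 2 ^ 2) :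
    radCut x = 0 :=
  Real.smoothTransition.zero_of_nonpos (by linarith)

theorem contDiff_hopfPart : ContDiff ℝ 1 hopfPart := by
  rw [contDiff_euclidean]
  intro i
  fin_cases i <;> simp only [hopfPart, Matrix.cons_val, Fin.zero_eta, Fin.mk_one,
      Fin.reduceFinMk] <;> fun_prop

theorem hopfPart_sq (u : EucA 4) : hopfPart u 0 ^ 2 + hopfPart u 1 ^ 2 + hopfPart u 2 ^ 2 =
    (u 0 ^ 2 + u 1 ^ 2) * circDist u + u 3 ^ 2 := by
  simp only [hopfPart, circDist, Matrix.cons_val]; ring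

theorem modelMap_of_circDist {u : EucA 4} (h : 2 / 5 < circDist u) : modelMap u = e3pt := by
  by_cases h' : circDist u < 1 / 2
  · rw [modelMap, if_pos h']
    refine collapse_eq_e3pt (radCut_eq_zero ?_)
    rw [hopfPart_sq]
    have h1 : (u 0 ^ 2 + u 1 ^ 2 - 1) ^ 2 < 1 / 2 := by
      have : circDist u = 4 * u 2 ^ 2 + (u 0 ^ 2 + u 1 ^ 2 - 1) ^ 2 := rfl
      nlinarith [sq_nonneg (u 2)]
    have h2 : 1 / 4 ≤ u 0 ^ 2 + u 1 ^ 2 := by nlinarith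
    nlinarith [sq_nonneg (u 3)]
  · rw [modelMap, if_neg h']

theorem modelMap_eq_of_notMem {u : EucA 4} (h : u ∉ modelBox) : modelMap u = e3pt := by
  by_cases h' : circDist u < 1 / 2
  swap
  · rw [modelMap, if_neg h']
  rw [modelMap, if_pos h']
  refine collapse_eq_e3pt (radCut_eq_zero ?_)
  rw [hopfPart_sq]
  by_contra hlt
  push Not at hlt
  apply h
  have hpi := Real.pi_gt_three
  have hc : circDist u = 4 * u 2 ^ 2 + (u 0 ^ 2 + u 1 ^ 2 - 1) ^ 2 := rfl
  have h1 : (u 0 ^ 2 + u 1 ^ 2 - 1) ^ 2 < 1 / 2 := by nlinarith [sq_nonneg (u 2)]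
  have h2 : u 0 ^ 2 + u 1 ^ 2 ≤ 9 / 4 := by nlinarith
  have h3 : 0 ≤ (u 0 ^ 2 + u 1 ^ 2) * circDist u := by
    rw [hc]; positivity
  have key : ∀ a b : ℝ, 0 ≤ b → a ^ 2 ≤ b ^ 2 → |a| ≤ b := fun a b hb hab => abs_le_of_sq_le_sq hab hb
  refine ⟨?_, ?_, ?_, ?_⟩ <;> refine key _ _ (by positivity) ?_ <;>
    nlinarith [sq_nonneg (u 0), sq_nonneg (u 1), sq_nonneg (u 2), sq_nonneg (u 3),
      sq_nonneg (u 0 ^ 2 + u 1 ^ 2 - 1)]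

theorem continuous_circDist : Continuous circDist := by unfold circDist; fun_prop

open Filter Topology in
theorem modelMap_eventuallyEq {u : EucA 4} :
    modelMap =ᶠ[𝓝 u] (fun u => collapse (hopfPart u)) ∨ modelMap =ᶠ[𝓝 u] fun _ => e3pt := by
  by_cases h : circDist u < 1 / 2
  · left
    filter_upwards [continuous_circDist.continuousAt.eventually (gt_mem_nhds h)] with v hv
    rw [modelMap, if_pos hv]
  · right
    have h' : 2 / 5 < circDist u := by linarith
    filter_upwards [continuous_circDist.continuousAt.eventually (lt_mem_nhds h')] with v hv
    exact modelMap_of_circDist hv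

theorem contDiff_modelMap : ContDiff ℝ 1 modelMap := by
  rw [contDiff_iff_contDiffAt]
  intro u
  rcases modelMap_eventuallyEq (u := u) with h | h
  · exact ((contDiff_collapse.comp contDiff_hopfPart).contDiffAt (x := u)).congr_of_eventuallyEq h
  · exact contDiffAt_const.congr_of_eventuallyEq h

theorem norm_modelMap (u : EucA 4) : ‖modelMap u‖ = 1 := by
  rw [modelMap]
  split_ifs
  · exact norm_collapse _
  · exact norm_e3pt

/-- The model map as a continuous map. -/
def modelMapC : C(EucA 4, EucA 4) := ⟨modelMap, contDiff_modelMap.continuous⟩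

theorem modelMap_form (u : EucA 4) : ∃ l B : ℝ, 0 < l ∧ 0 ≤ B ∧
    modelMap u = l • !₂[B * hopfPart u 0, B * hopfPart u 1, 1 - 2 * B, B * u 3] ∧
    (B ≠ 0 → circDist u < 1 / 2) ∧ (hopfPart u = 0 → circDist u < 1 / 2 → B = 1) := by
  by_cases h : circDist u < 1 / 2
  · refine ⟨‖rawCollapse (hopfPart u)‖⁻¹, radCut (hopfPart u),
      inv_pos.2 (norm_pos_iff.2 (rawCollapse_ne_zero _)), Real.smoothTransition.nonneg _, ?_,
      fun _ => h, fun h0 _ => ?_⟩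
    · rw [modelMap, if_pos h, collapse, rawCollapse]; rfl
    · simp [radCut, h0]
  · refine ⟨1, 0, one_pos, le_rfl, ?_, fun h0 => absurd rfl h0, fun _ h' => absurd h' h⟩
    rw [modelMap, if_neg h]; simp [e3pt]

/-- The model map and the polynomial model are homotopic by a linear homotopy. -/
theorem admHomotopic_hopfPolyC_modelMapC : AdmHomotopic hopfPolyC modelMapC := by
  refine admHomotopic_of_continuousOn (ρ := 2)
    (fun s u => s • modelMapC u + (1 - s) • hopfPolyC u) ?_ ?_ (fun u => by simp) (fun u => by simp)
  · have := modelMapC.continuous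
    have := hopfPolyC.continuous
    exact (by fun_prop : Continuous _).continuousOn
  · rintro s ⟨hs0, hs1⟩
    have main : ∀ u : EucA 4, ∃ κ w : ℝ,
        (s • modelMapC u + (1 - s) • hopfPolyC u = !₂[κ * hopfPart u 0, κ * hopfPart u 1, w, κ * u 3])
        ∧ (κ = 0 → 0 < w) ∧ (hopfPart u = 0 → w ≠ 0) ∧
        (1 / 2 ≤ circDist u → 0 < w) := by
      intro u
      obtain ⟨l, B, hl, hB, he, hBc, hB1⟩ := modelMap_form u
      refine ⟨s * l * B + (1 - s), s * l * (1 - 2 * B) + (1 - s) * (circDist u - 1 / 4), ?_, ?_, ?_,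
        ?_⟩
      · change s • modelMap u + (1 - s) • (WithLp.toLp 2 (hopfPoly u) : EucA 4) = _
        rw [he]
        ext i
        fin_cases i <;> simp [hopfPoly, hopfPart, circDist] <;> ring
      · intro h
        have h1 : 0 ≤ s * l * B := by positivity
        have hs : s = 1 := by linarith
        rw [hs] at h ⊢
        have hB0 : B = 0 := by
          have : l * B = 0 := by linarith
          exact (mul_eq_zero.1 this).resolve_left hl.ne'
        rw [hB0]; simpa using hl
      · intro h
        by_cases hc : circDist u < 1 / 2
        · rw [hB1 h hc]
          have hsq : (u 0 ^ 2 + u 1 ^ 2) * circDist u + u 3 ^ 2 = 0 := by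
            rw [← hopfPart_sq, h]; simp
          have hcd : circDist u = 4 * u 2 ^ 2 + (u 0 ^ 2 + u 1 ^ 2 - 1) ^ 2 := rfl
          have hc0 : 0 ≤ circDist u := by rw [hcd]; positivity
          have h1 : 1 / 4 ≤ u 0 ^ 2 + u 1 ^ 2 := by nlinarith [sq_nonneg (u 2)]
          have h2 : circDist u = 0 := by nlinarith [sq_nonneg (u 3)]
          rw [h2]
          nlinarith [mul_nonneg hs0 hl.le, mul_pos hl hl]
        · have hB0 : B = 0 := by
            by_contra hB0
            exact hc (hBc hB0)
          rw [hB0]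
          rcases hs0.eq_or_lt with h0 | h0
          · rw [← h0]; nlinarith
          · have := mul_pos h0 hl
            nlinarith
      · intro hc
        have hB0 : B = 0 := by
          by_contra hB0
          linarith [hBc hB0]
        rw [hB0]
        rcases hs0.eq_or_lt with h0 | h0
        · rw [← h0]; linarith
        · have := mul_pos h0 hl
          nlinarith
    constructor
    · intro u h
      obtain ⟨κ, w, he, h1, h2, h3⟩ := main u
      simp only at h
      rw [he] at h
      have a0 : κ * hopfPart u 0 = 0 := congrArg (fun v : EucA 4 => v 0) h
      have a1 : κ * hopfPart u 1 = 0 := congrArg (fun v : EucA 4 => v 1) h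
      have a2 : w = 0 := congrArg (fun v : EucA 4 => v 2) h
      have a3 : κ * u 3 = 0 := congrArg (fun v : EucA 4 => v 3) h
      by_cases hκ : κ = 0
      · linarith [h1 hκ]
      · refine h2 ?_ a2
        ext i
        fin_cases i
        · exact (mul_eq_zero.1 a0).resolve_left hκ
        · exact (mul_eq_zero.1 a1).resolve_left hκ
        · exact (mul_eq_zero.1 a3).resolve_left hκ
    · intro u hu
      obtain ⟨κ, w, he, h1, h2, h3⟩ := main u
      by_contra h
      push Not at h
      simp only at h
      rw [he] at h
      have a2 : w = 0 := h.1
      have a3 : κ * u 3 = 0 := h.2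
      by_cases hκ : κ = 0
      · linarith [h1 hκ]
      · have h3' := (mul_eq_zero.1 a3).resolve_left hκ
        have hn : 4 ≤ u 0 ^ 2 + u 1 ^ 2 + u 2 ^ 2 := by
          have e := EuclideanSpace.real_norm_sq_eq u
          rw [Fin.sum_univ_four, h3'] at e
          nlinarith
        have hcd : circDist u = 4 * u 2 ^ 2 + (u 0 ^ 2 + u 1 ^ 2 - 1) ^ 2 := rfl
        have : 1 / 2 ≤ circDist u := by
          rw [hcd]
          rcases le_total 1 (u 2 ^ 2) with h5 | h5
          · nlinarith [sq_nonneg (u 0 ^ 2 + u 1 ^ 2 - 1)]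
          · nlinarith [sq_nonneg (u 2)]
        linarith [h3 this]

end Model

section Dilation

theorem abs_det_three_le (X : Matrix (Fin 3) (Fin 3) ℝ) {b c : ℝ}
    (h0 : ∀ i, |X i 0| ≤ b) (h1 : ∀ i, |X i 1| ≤ b) (h2 : ∀ i, |X i 2| ≤ c) :
    |X.det| ≤ 6 * (b ^ 2 * c) := by
  have hb : 0 ≤ b := (abs_nonneg _).trans (h0 0)
  have key : ∀ i j k : Fin 3, |X i 0 * X j 1 * X k 2| ≤ b ^ 2 * c := fun i j k => by
    rw [abs_mul, abs_mul, sq]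
    exact mul_le_mul (mul_le_mul (h0 i) (h1 j) (abs_nonneg _) hb) (h2 k) (abs_nonneg _)
      (by positivity)
  rw [Matrix.det_fin_three, abs_le]
  have e := fun i j k => abs_le.1 (key i j k)
  constructor <;>
  linarith [(e 0 1 2).1, (e 0 1 2).2, (e 0 2 1).1, (e 0 2 1).2, (e 1 0 2).1, (e 1 0 2).2,
    (e 1 2 0).1, (e 1 2 0).2, (e 2 0 1).1, (e 2 0 1).2, (e 2 1 0).1, (e 2 1 0).2]

/-- The Gram matrix of a frame in the image of a linear map out of `ℝ³`. -/
theorem gram_eq_mul {F : Type*} [NormedAddCommGroup F] [InnerProductSpace ℝ F]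
    (D : EucA 3 →L[ℝ] F) (w : Fin 3 → EucA 3) :
    (Matrix.of fun i j : Fin 3 => ⟪D (w i), D (w j)⟫) =
      (Matrix.of fun i k : Fin 3 => w i k) *
        (Matrix.of fun k l : Fin 3 => ⟪D (EuclideanSpace.single k 1),
          D (EuclideanSpace.single l 1)⟫) * (Matrix.of fun i k : Fin 3 => w i k).transpose := by
  have hw : ∀ x : EucA 3, D x = ∑ k, x k • D (EuclideanSpace.single k 1) := fun x => by
    have hx : x = ∑ k, x k • EuclideanSpace.single k (1 : ℝ) := by
      ext i
      fin_cases i <;> simp [Fin.sum_univ_three]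
    conv_lhs => rw [hx]
    simp
  ext i j
  rw [Matrix.of_apply, hw (w i), hw (w j)]
  simp only [Matrix.mul_apply, Matrix.of_apply, Matrix.transpose_apply, Fin.sum_univ_three,
    inner_add_left, inner_add_right, real_inner_smul_left, real_inner_smul_right]
  ring

theorem sqrt_gram_le {F : Type*} [NormedAddCommGroup F] [InnerProductSpace ℝ F]
    (D : EucA 3 →L[ℝ] F) (w : Fin 3 → EucA 3) {K b c : ℝ} (hc : 0 ≤ c) (hD : ‖D‖ ≤ K)
    (hb : ∀ i, ‖w i‖ ≤ b) (h2 : ∀ i, |w i 2| ≤ c) :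
    Real.sqrt (Matrix.of fun i j : Fin 3 => ⟪D (w i), D (w j)⟫).det ≤
      18 * K ^ 3 * (b ^ 2 * c) := by
  have hK : 0 ≤ K := (norm_nonneg _).trans hD
  have hcoord : ∀ i k, |w i k| ≤ b := fun i k => by
    have := PiLp.norm_apply_le (w i) k
    rw [Real.norm_eq_abs] at this
    exact this.trans (hb i)
  have hX := abs_det_three_le (Matrix.of fun i k : Fin 3 => w i k) (b := b) (c := c)
    (fun i => hcoord i 0) (fun i => hcoord i 1) h2
  have hG : |(Matrix.of fun k l : Fin 3 => ⟪D (EuclideanSpace.single k 1),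
      D (EuclideanSpace.single l 1)⟫).det| ≤ 6 * ((K ^ 2) ^ 2 * K ^ 2) := by
    have : ∀ k l : Fin 3, |⟪D (EuclideanSpace.single k 1), D (EuclideanSpace.single l 1)⟫| ≤
        K ^ 2 := fun k l => by
      have hn : ∀ k : Fin 3, ‖D (EuclideanSpace.single k 1)‖ ≤ K := fun k => by
        refine (D.le_opNorm _).trans ?_
        simpa using hD
      refine (abs_real_inner_le_norm _ _).trans ?_
      rw [sq]
      exact mul_le_mul (hn k) (hn l) (norm_nonneg _) hK
    exact abs_det_three_le _ (fun i => this i 0) (fun i => this i 1) (fun i => this i 2)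
  rw [gram_eq_mul, Matrix.det_mul, Matrix.det_mul, Matrix.det_transpose]
  refine Real.sqrt_le_iff.2 ⟨by positivity, ?_⟩
  set dX := (Matrix.of fun i k : Fin 3 => w i k).det
  set dG := (Matrix.of fun k l : Fin 3 => ⟪D (EuclideanSpace.single k 1),
      D (EuclideanSpace.single l 1)⟫).det
  calc dX * dG * dX = dX ^ 2 * dG := by ring
    _ ≤ (6 * (b ^ 2 * c)) ^ 2 * (6 * ((K ^ 2) ^ 2 * K ^ 2)) := by
        refine mul_le_mul_of_nonneg (sq_le_sq' (abs_le.1 hX).1 (abs_le.1 hX).2)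
          ((le_abs_self _).trans hG) (sq_nonneg _) (by positivity)
    _ ≤ _ := by
        have : 0 ≤ (b ^ 2 * c * K ^ 3) ^ 2 := sq_nonneg _
        nlinarith

theorem lamNorm_three_zero {V F : Type*} [NormedAddCommGroup V] [InnerProductSpace ℝ V]
    [NormedAddCommGroup F] [InnerProductSpace ℝ F] : lamNorm 3 (0 : V →ₗ[ℝ] F) ≤ 0 := by
  refine Real.iSup_le (fun v => ?_) le_rfl
  simp [Matrix.det_fin_three]

theorem isCompact_modelBox : IsCompact modelBox := by
  have hcl : IsClosed modelBox := by
    have h : ∀ i : Fin 4, ∀ r : ℝ, IsClosed {u : EucA 4 | |u i| ≤ r} := fun i r =>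
      isClosed_le (by fun_prop) continuous_const
    exact (h 0 _).inter ((h 1 _).inter ((h 2 _).inter (h 3 _)))
  refine Metric.isCompact_of_isClosed_isBounded hcl
    (isBounded_iff_forall_norm_le.2 ⟨8, fun u hu => ?_⟩)
  obtain ⟨h0, h1, h2, h3⟩ := hu
  have hpi := Real.pi_lt_four
  have hs : ∀ a b : ℝ, |a| ≤ b → b ≤ 2 → a ^ 2 ≤ 4 := fun a b h hb => by
    nlinarith [abs_le.1 h, sq_abs a, abs_nonneg a]
  rw [EuclideanSpace.norm_eq]
  refine Real.sqrt_le_iff.2 ⟨by norm_num, ?_⟩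
  simp only [Real.norm_eq_abs, sq_abs, Fin.sum_univ_four]
  linarith [hs _ _ h0 (by linarith), hs _ _ h1 (by linarith), hs _ _ h2 (by linarith),
    hs _ _ h3 (by norm_num)]

open Topology in
theorem modelMap_eventuallyEq_const {u : EucA 4} (h : u ∉ modelBox) :
    modelMap =ᶠ[𝓝 u] fun _ => e3pt := by
  filter_upwards [isCompact_modelBox.isClosed.isOpen_compl.mem_nhds h] with v hv
  exact modelMap_eq_of_notMem hv

theorem fderiv_hopfPart_two (x v : EucA 4) : fderiv ℝ hopfPart x v 2 = v 3 := by
  have h := ((contDiff_hopfPart.differentiable one_ne_zero) x).hasFDerivAt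
  have h2 : HasFDerivAt (fun u => hopfPart u 2) ((EuclideanSpace.proj 2).comp
      (fderiv ℝ hopfPart x)) x :=
    ((EuclideanSpace.proj (𝕜 := ℝ) (2 : Fin 3)).hasFDerivAt (x := hopfPart x)).comp x h
  have h3 : HasFDerivAt (fun u : EucA 4 => hopfPart u 2)
      (EuclideanSpace.proj (𝕜 := ℝ) (3 : Fin 4)) x :=
    (EuclideanSpace.proj (𝕜 := ℝ) (3 : Fin 4)).hasFDerivAt (x := x)
  exact congrArg (fun L : EucA 4 →L[ℝ] ℝ => L v) (h2.unique h3)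

theorem exists_lamNorm_modelMap_le : ∃ C : ℝ, 0 ≤ C ∧ ∀ (x : EucA 4) {V : Type}
    [NormedAddCommGroup V] [InnerProductSpace ℝ V] (T : V →ₗ[ℝ] EucA 4) (a c : ℝ), 0 ≤ a →
    0 ≤ c → (∀ v, ‖v‖ = 1 → ‖T v‖ ≤ a ∧ |T v 3| ≤ c) →
    lamNorm 3 ((fderiv ℝ modelMap x).toLinearMap ∘ₗ T) ≤ C * a ^ 2 * c := by
  obtain ⟨K, hK⟩ := isCompact_modelBox.exists_bound_of_continuousOn
    (f := fun x => fderiv ℝ collapse (hopfPart x))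
    ((contDiff_collapse.continuous_fderiv one_ne_zero).comp
      contDiff_hopfPart.continuous).continuousOn
  obtain ⟨M, hM⟩ := isCompact_modelBox.exists_bound_of_continuousOn
    (f := fun x => fderiv ℝ hopfPart x)
    (contDiff_hopfPart.continuous_fderiv one_ne_zero).continuousOn
  refine ⟨18 * |K| ^ 3 * M ^ 2, by positivity, fun x V _ _ T a c ha hc hT => ?_⟩
  have hpos : 0 ≤ 18 * |K| ^ 3 * M ^ 2 * a ^ 2 * c := by positivity
  have hzero : modelMap =ᶠ[nhds x] (fun _ => e3pt) →
      lamNorm 3 ((fderiv ℝ modelMap x).toLinearMap ∘ₗ T) ≤ 18 * |K| ^ 3 * M ^ 2 * a ^ 2 * c := by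
    intro h
    have : fderiv ℝ modelMap x = 0 := by rw [h.fderiv_eq]; simp
    rw [this, ContinuousLinearMap.toLinearMap_zero, LinearMap.zero_comp]
    exact lamNorm_three_zero.trans hpos
  by_cases hx : x ∈ modelBox
  swap
  · exact hzero (modelMap_eventuallyEq_const hx)
  rcases modelMap_eventuallyEq (u := x) with h | h
  swap
  · exact hzero h
  refine Real.iSup_le (fun v => ?_) hpos
  have hf : fderiv ℝ modelMap x = (fderiv ℝ collapse (hopfPart x)).comp (fderiv ℝ hopfPart x) := by
    rw [h.fderiv_eq]
    exact fderiv_comp x (contDiff_collapse.differentiable one_ne_zero _)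
      (contDiff_hopfPart.differentiable one_ne_zero _)
  have hv : ∀ i, ‖v.1 i‖ = 1 := v.2.1
  have := sqrt_gram_le (fderiv ℝ collapse (hopfPart x))
    (fun i => fderiv ℝ hopfPart x (T (v.1 i))) (K := |K|) (b := M * a) hc
    ((hK x hx).trans (le_abs_self K))
    (fun i => ((fderiv ℝ hopfPart x).le_opNorm _).trans
      (mul_le_mul (hM x hx) (hT _ (hv i)).1 (norm_nonneg _) ((norm_nonneg _).trans (hM x hx))))
    (fun i => by rw [fderiv_hopfPart_two]; exact (hT _ (hv i)).2)
  rw [hf]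
  refine this.trans (le_of_eq (by ring))

end Dilation

section CollapseChart

open Filter Topology

/-- A partially defined chart at `x₀ ∈ S⁴`: a map `Y` to `ℝ⁴` which is continuous where it takes
values in `modelBox`, with a unique and nondegenerate zero `x₀`. -/
structure IsCollapseChart (Y : EucA 5 → EucA 4) (x₀ : EucA 5) : Prop where
  norm_eq_one : ‖x₀‖ = 1
  continuousAt : ∀ y ∈ usph 5, (∀ᶠ y' in 𝓝 y, Y y' ∉ modelBox) ∨ ContinuousAt Y y
  apply_eq_zero : Y x₀ = 0
  eq_of_apply_eq_zero : ∀ y ∈ usph 5, Y y = 0 → y = x₀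
  antipode : ∀ᶠ y in 𝓝 (-x₀), Y y ∉ modelBox
  deriv : ∃ L : EucA 5 →L[ℝ] EucA 4, HasFDerivAt Y L x₀ ∧ ∀ v, ⟪x₀, v⟫ = 0 → L v = 0 → v = 0

theorem smul_notMem_modelBox {u : EucA 4} (hu : u ∉ modelBox) {s : ℝ} (hs : 1 ≤ s) :
    s • u ∉ modelBox := by
  intro h
  apply hu
  have key : ∀ {a b : ℝ}, |s * a| ≤ b → |a| ≤ b := fun {a b} h => by
    rw [abs_mul, abs_of_nonneg (by linarith)] at h
    nlinarith [abs_nonneg a]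
  exact ⟨key h.1, key h.2.1, key h.2.2.1, key h.2.2.2⟩

theorem norm_lt_of_mem_modelBox {u : EucA 4} (hu : u ∈ modelBox) : ‖u‖ < 9 := by
  obtain ⟨h0, h1, h2, h3⟩ := hu
  have hpi := Real.pi_lt_four
  have hs : ∀ a b : ℝ, |a| ≤ b → b ≤ 2 → a ^ 2 ≤ 4 := fun a b h hb => by
    nlinarith [abs_le.1 h, sq_abs a, abs_nonneg a]
  rw [EuclideanSpace.norm_eq, Real.sqrt_lt' (by norm_num)]
  simp only [Real.norm_eq_abs, sq_abs, Fin.sum_univ_four]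
  linarith [hs _ _ h0 (by linarith), hs _ _ h1 (by linarith), hs _ _ h2 (by linarith),
    hs _ _ h3 (by norm_num)]

theorem tendsto_stereoInvFunAux {E : Type*} [NormedAddCommGroup E] [InnerProductSpace ℝ E]
    (v : E) : Tendsto (stereoInvFunAux v) (Bornology.cobounded E) (𝓝 v) := by
  rw [tendsto_iff_norm_sub_tendsto_zero]
  have hlim : Tendsto (fun w : E => (4 + 8 * ‖v‖) * ‖w‖⁻¹) (Bornology.cobounded E) (𝓝 0) := by
    have := (tendsto_inv_atTop_zero.comp (tendsto_norm_cobounded_atTop (E := E))).const_mul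
      (4 + 8 * ‖v‖)
    simpa using this
  refine squeeze_zero' (Eventually.of_forall fun _ => norm_nonneg _) ?_ hlim
  filter_upwards [tendsto_norm_cobounded_atTop.eventually_ge_atTop (1 : ℝ)] with w hw
  have h0 : (‖w‖ ^ 2 + 4) ≠ 0 := by positivity
  have : stereoInvFunAux v w - v = (‖w‖ ^ 2 + 4)⁻¹ • ((4 : ℝ) • w - (8 : ℝ) • v) := by
    rw [stereoInvFunAux]
    have : v = (‖w‖ ^ 2 + 4)⁻¹ • (‖w‖ ^ 2 + 4) • v := by rw [inv_smul_smul₀ h0]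
    nth_rewrite 2 [this]
    rw [← smul_sub]
    congr 1
    module
  rw [this, norm_smul, norm_inv, Real.norm_of_nonneg (by positivity)]
  have h1 : ‖(4 : ℝ) • w - (8 : ℝ) • v‖ ≤ 4 * ‖w‖ + 8 * ‖v‖ := by
    refine (norm_sub_le _ _).trans (le_of_eq ?_)
    rw [norm_smul, norm_smul]; norm_num
  have h2 : 4 * ‖w‖ + 8 * ‖v‖ ≤ (4 + 8 * ‖v‖) * ‖w‖ := by nlinarith [norm_nonneg v]
  rw [inv_mul_le_iff₀ (by positivity)]
  refine (h1.trans h2).trans ?_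
  have : ‖w‖ ≠ 0 := by positivity
  have h3 : (‖w‖ ^ 2 + 4) * ((4 + 8 * ‖v‖) * ‖w‖⁻¹) =
      (4 + 8 * ‖v‖) * ‖w‖ + 4 * (4 + 8 * ‖v‖) * ‖w‖⁻¹ := by field_simp
  rw [h3]
  have : 0 ≤ 4 * (4 + 8 * ‖v‖) * ‖w‖⁻¹ := by positivity
  linarith

variable {Y : EucA 5 → EucA 4} {x₀ : EucA 5}

/-- Stereographic coordinates on `S⁴` adapted to a chart. -/
theorem IsCollapseChart.exists_stereographic (h : IsCollapseChart Y x₀) :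
    ∃ G : EucA 4 → EucA 5, Continuous G ∧ (∀ z, G z ∈ usph 5) ∧ G 0 = x₀ ∧
      (∀ z, G z = x₀ → z = 0) ∧ Tendsto G (Bornology.cobounded _) (𝓝 (-x₀)) ∧
      HasFDerivAt (fun z => Y (G z)) (ContinuousLinearMap.id ℝ (EucA 4)) 0 := by
  obtain ⟨L, hL, hinj⟩ := h.deriv
  have hx0 : x₀ ≠ 0 := by rw [← norm_ne_zero_iff, h.norm_eq_one]; exact one_ne_zero
  have hmem : ∀ v, v ∈ (ℝ ∙ x₀)ᗮ ↔ ⟪x₀, v⟫ = 0 := fun v => 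
    Submodule.mem_orthogonal_singleton_iff_inner_right
  have : Fact (Module.finrank ℝ (EucA 5) = 4 + 1) := ⟨by simp⟩
  have hfr : Module.finrank ℝ (ℝ ∙ x₀)ᗮ = Module.finrank ℝ (EucA 4) := by
    rw [Submodule.finrank_orthogonal_span_singleton (n := 4) hx0]; simp
  let e := LinearMap.linearEquivOfInjective (L.toLinearMap ∘ₗ (ℝ ∙ x₀)ᗮ.subtype)
    (by
      rw [injective_iff_map_eq_zero]
      intro v hv
      exact Subtype.ext (hinj _ ((hmem _).1 v.2) hv)) hfr
  let T : EucA 4 →L[ℝ] EucA 5 := LinearMap.toContinuousLinearMap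
    ((ℝ ∙ x₀)ᗮ.subtype ∘ₗ e.symm.toLinearMap)
  have hT : ∀ z, ⟪x₀, T z⟫ = 0 := fun z => (hmem _).1 (e.symm z).2
  have hLT : ∀ z, L (T z) = z := fun z => e.apply_symm_apply z
  have hnorm : ‖-x₀‖ = 1 := by rw [norm_neg, h.norm_eq_one]
  refine ⟨fun z => stereoInvFunAux (-x₀) (T z), ?_, fun z => ?_, ?_, fun z hz => ?_, ?_, ?_⟩
  · exact (contDiff_stereoInvFunAux (m := 0)).continuous.comp T.continuous
  · exact stereoInvFunAux_mem hnorm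
      (Submodule.mem_orthogonal_singleton_iff_inner_right.2 (by rw [inner_neg_left, hT, neg_zero]))
  · simp [stereoInvFunAux]
  · have h4 : (‖T z‖ ^ 2 + 4) ≠ 0 := by positivity
    beta_reduce at hz
    rw [stereoInvFunAux_apply, inv_smul_eq_iff₀ h4] at hz
    have := congrArg (fun v => ⟪x₀, v⟫) hz
    simp only [inner_add_right, real_inner_smul_right, hT, inner_neg_right,
      real_inner_self_eq_norm_sq, h.norm_eq_one] at this
    have h5 : ‖T z‖ = 0 := by
      have : ‖T z‖ ^ 2 = 0 := by linarith
      exact pow_eq_zero_iff two_ne_zero |>.1 this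
    rw [← hLT z, norm_eq_zero.1 h5, map_zero]
  · refine (tendsto_stereoInvFunAux (-x₀)).comp ?_
    rw [← tendsto_norm_atTop_iff_cobounded]
    have hb : ∀ z, ‖z‖ ≤ (‖L‖ + 1) * ‖T z‖ := fun z => by
      calc ‖z‖ = ‖L (T z)‖ := by rw [hLT]
        _ ≤ ‖L‖ * ‖T z‖ := L.le_opNorm _
        _ ≤ _ := by nlinarith [norm_nonneg (T z)]
    refine tendsto_atTop_mono (f := fun z => (‖L‖ + 1)⁻¹ * ‖z‖) (fun z => ?_) ?_
    · rw [inv_mul_le_iff₀ (by positivity)]; exact hb z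
    · exact tendsto_norm_cobounded_atTop.const_mul_atTop (by positivity)
  · have h1 : HasFDerivAt (fun z => stereoInvFunAux (-x₀) (T z))
        ((ContinuousLinearMap.id ℝ (EucA 5)).comp T) 0 := by
      refine HasFDerivAt.comp (0 : EucA 4) (g := stereoInvFunAux (-x₀)) ?_ T.hasFDerivAt
      rw [map_zero]
      exact hasFDerivAt_stereoInvFunAux _
    have h2 : HasFDerivAt Y L (stereoInvFunAux (-x₀) (T 0)) := by
      simpa [stereoInvFunAux, inv_mul_cancel₀] using hL
    refine (h2.comp (0 : EucA 4) h1).congr_fderiv ?_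
    ext z : 1
    exact hLT z

end CollapseChart

section SphereHomotopy

open Filter Topology

variable {Y : EucA 5 → EucA 4} {x₀ : EucA 5}

theorem IsCollapseChart.exists_le_norm (h : IsCollapseChart Y x₀) {G : EucA 4 → EucA 5}
    (hG : Continuous G) (hmem : ∀ z, G z ∈ usph 5) (hG0 : G 0 = x₀) (hinj : ∀ z, G z = x₀ → z = 0)
    (hlim : Tendsto G (Bornology.cobounded _) (𝓝 (-x₀)))
    (hd : HasFDerivAt (fun z => Y (G z)) (ContinuousLinearMap.id ℝ (EucA 4)) 0) :
    ∃ c > 0, ∀ w, Y (G w) ∈ modelBox → c * ‖w‖ ≤ ‖Y (G w)‖ := by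
  obtain ⟨R, -, hR⟩ := (hasBasis_cobounded_norm (E := EucA 4)).mem_iff.1
    (hlim.eventually h.antipode)
  suffices H : ∃ c > 0, ∀ w ∈ Metric.closedBall (0 : EucA 4) R,
      Y (G w) ∈ modelBox → c * ‖w‖ ≤ ‖Y (G w)‖ by
    obtain ⟨c, hc, H⟩ := H
    refine ⟨c, hc, fun w hw => H w ?_ hw⟩
    rw [mem_closedBall_zero_iff]
    by_contra hlt
    exact hR (not_le.1 hlt).le hw
  refine (isCompact_closedBall (0 : EucA 4) R).induction_on
    (p := fun s => ∃ c > 0, ∀ w ∈ s, Y (G w) ∈ modelBox → c * ‖w‖ ≤ ‖Y (G w)‖)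
    ⟨1, one_pos, fun w hw => hw.elim⟩ ?_ ?_ ?_
  · rintro s t hst ⟨c, hc, ht⟩
    exact ⟨c, hc, fun w hw => ht w (hst hw)⟩
  · rintro s t ⟨c, hc, hs⟩ ⟨c', hc', ht⟩
    refine ⟨min c c', lt_min hc hc', fun w hw hb => ?_⟩
    rcases hw with hw | hw
    · exact (mul_le_mul_of_nonneg_right (min_le_left _ _) (norm_nonneg _)).trans (hs w hw hb)
    · exact (mul_le_mul_of_nonneg_right (min_le_right _ _) (norm_nonneg _)).trans (ht w hw hb)
  · intro w₀ _
    suffices H : ∃ c > 0, ∀ᶠ w in 𝓝 w₀, Y (G w) ∈ modelBox → c * ‖w‖ ≤ ‖Y (G w)‖ by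
      obtain ⟨c, hc, H⟩ := H
      exact ⟨_, mem_nhdsWithin_of_mem_nhds H, c, hc, fun w hw => hw⟩
    rcases eq_or_ne w₀ 0 with rfl | hw₀
    · refine ⟨1 / 2, by norm_num, ?_⟩
      filter_upwards [hd.isLittleO.def (show (0 : ℝ) < 1 / 2 by norm_num)] with w hw _
      simp only [hG0, h.apply_eq_zero, sub_zero, ContinuousLinearMap.id_apply] at hw
      have := norm_sub_norm_le w (w - Y (G w))
      rw [sub_sub_cancel, norm_sub_rev w] at this
      linarith
    · rcases h.continuousAt _ (hmem w₀) with hout | hcont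
      · exact ⟨1, one_pos, (hG.continuousAt.eventually hout).mono fun w hw hb => (hw hb).elim⟩
      · have hne : 0 < ‖Y (G w₀)‖ := norm_pos_iff.2 fun h0 =>
          hw₀ (hinj _ (h.eq_of_apply_eq_zero _ (hmem _) h0))
        have hw0 : 0 < ‖w₀‖ := norm_pos_iff.2 hw₀
        refine ⟨‖Y (G w₀)‖ / (2 * ‖w₀‖), by positivity, ?_⟩
        have hc : ContinuousAt (fun w => ‖Y (G w)‖) w₀ :=
          (ContinuousAt.comp (g := Y) hcont hG.continuousAt).norm
        have hc' : ContinuousAt (fun w : EucA 4 => ‖Y (G w₀)‖ / (2 * ‖w₀‖) * ‖w‖) w₀ := by fun_prop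
        refine (hc'.eventually_lt hc ?_).mono fun w hw _ => hw.le
        field_simp
        linarith

theorem tendsto_rescale {g : EucA 4 → EucA 4} (hg0 : g 0 = 0)
    (hd : HasFDerivAt g (ContinuousLinearMap.id ℝ (EucA 4)) 0) (z₀ : EucA 4) :
    ContinuousAt (fun q : ℝ × EucA 4 => if q.1 = 0 then q.2 else q.1⁻¹ • g (q.1 • q.2)) (0, z₀) := by
  have hsub : Tendsto (fun q : ℝ × EucA 4 =>
      (if q.1 = 0 then q.2 else q.1⁻¹ • g (q.1 • q.2)) - q.2) (𝓝 (0, z₀)) (𝓝 0) := by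
    rw [Metric.tendsto_nhds]
    intro ε hε
    have hm : Tendsto (fun q : ℝ × EucA 4 => q.1 • q.2) (𝓝 (0, z₀)) (𝓝 0) := by
      have : Continuous fun q : ℝ × EucA 4 => q.1 • q.2 := by fun_prop
      simpa using this.tendsto (0, z₀)
    have hb : ∀ᶠ q : ℝ × EucA 4 in 𝓝 (0, z₀), ‖q.2‖ < ‖z₀‖ + 1 :=
      (continuous_snd.norm.tendsto ((0 : ℝ), z₀)).eventually_lt_const (lt_add_one _)
    filter_upwards [hm.eventually (hd.isLittleO.def (show 0 < ε / (‖z₀‖ + 1) by positivity)), hb]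
      with q hq hqb
    rw [dist_zero_right]
    split_ifs with h0
    · simpa using hε
    · simp only [hg0, sub_zero, ContinuousLinearMap.id_apply] at hq
      have he : q.1⁻¹ • g (q.1 • q.2) - q.2 = q.1⁻¹ • (g (q.1 • q.2) - q.1 • q.2) := by
        rw [smul_sub, inv_smul_smul₀ h0]
      rw [he, norm_smul, norm_inv, inv_mul_lt_iff₀ (norm_pos_iff.2 h0)]
      refine hq.trans_lt ?_
      rw [norm_smul, mul_left_comm]
      refine mul_lt_mul_of_pos_left ?_ (norm_pos_iff.2 h0)
      rw [div_mul_eq_mul_div, div_lt_iff₀ (by positivity)]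
      exact mul_lt_mul_of_pos_left hqb hε
  have := hsub.add (continuous_snd.tendsto ((0 : ℝ), z₀))
  simp only [sub_add_cancel, zero_add] at this
  simpa [ContinuousAt] using this

theorem IsCollapseChart.admHomotopic_modelMapC (h : IsCollapseChart Y x₀) {G : EucA 4 → EucA 5}
    (hG : Continuous G) (hmem : ∀ z, G z ∈ usph 5) (hG0 : G 0 = x₀) (hinj : ∀ z, G z = x₀ → z = 0)
    (hlim : Tendsto G (Bornology.cobounded _) (𝓝 (-x₀)))
    (hd : HasFDerivAt (fun z => Y (G z)) (ContinuousLinearMap.id ℝ (EucA 4)) 0)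
    (F : C(EucA 4, EucA 4)) (hF : ∀ z, F z = modelMap (Y (G z))) : AdmHomotopic modelMapC F := by
  obtain ⟨c, hc, hcw⟩ := h.exists_le_norm hG hmem hG0 hinj hlim hd
  refine admHomotopic_of_continuousOn (ρ := max 9 (9 / c))
    (fun t z => modelMap (if t = 0 then z else t⁻¹ • Y (G (t • z)))) ?_ ?_ ?_ ?_
  · rintro ⟨t, z⟩ ⟨ht, -⟩
    rcases eq_or_ne t 0 with rfl | ht0
    · refine ContinuousAt.continuousWithinAt ?_
      refine ContinuousAt.comp (g := modelMap) contDiff_modelMap.continuous.continuousAt ?_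
      exact tendsto_rescale (g := fun z => Y (G z)) (by simp only [hG0, h.apply_eq_zero]) hd z
    · have hne : ∀ᶠ q : ℝ × EucA 4 in 𝓝 (t, z), q.1 ≠ 0 :=
        continuous_fst.continuousAt.eventually_ne ht0
      have hGc : Continuous fun q : ℝ × EucA 4 => G (q.1 • q.2) := by fun_prop
      rcases h.continuousAt _ (hmem (t • z)) with hout | hcont
      · refine (continuousWithinAt_const (b := e3pt)).congr_of_eventuallyEq ?_ ?_
        · filter_upwards [mem_nhdsWithin_of_mem_nhds hne, self_mem_nhdsWithin,
            mem_nhdsWithin_of_mem_nhds ((hGc.tendsto (t, z)).eventually hout)] with q h0 hq hY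
          rw [if_neg h0]
          have h0' : 0 < q.1 := lt_of_le_of_ne hq.1.1 (Ne.symm h0)
          exact modelMap_eq_of_notMem
            (smul_notMem_modelBox hY ((one_le_inv₀ h0').2 hq.1.2))
        · rw [if_neg ht0]
          have h0' : 0 < t := lt_of_le_of_ne ht.1 (Ne.symm ht0)
          exact modelMap_eq_of_notMem
            (smul_notMem_modelBox hout.self_of_nhds ((one_le_inv₀ h0').2 ht.2))
      · refine ContinuousAt.continuousWithinAt ?_
        refine ContinuousAt.comp (g := modelMap) contDiff_modelMap.continuous.continuousAt ?_
        have h1 : ContinuousAt (fun q : ℝ × EucA 4 => q.1⁻¹ • Y (G (q.1 • q.2))) (t, z) :=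
          (continuous_fst.continuousAt.inv₀ ht0).smul
            (ContinuousAt.comp (g := Y) hcont hGc.continuousAt)
        refine h1.congr ?_
        filter_upwards [hne] with q hq
        rw [if_neg hq]
  · intro t ht
    refine ⟨fun z => norm_ne_zero_iff.1 (by rw [norm_modelMap]; exact one_ne_zero), fun z hz => ?_⟩
    have hz' : 9 ≤ c * ‖z‖ := by
      rw [← div_le_iff₀' hc]; exact (le_max_right _ _).trans hz
    have hout : (if t = 0 then z else t⁻¹ • Y (G (t • z))) ∉ modelBox := by
      intro hb
      have hlt := norm_lt_of_mem_modelBox hb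
      split_ifs at hb hlt with h0
      · exact hlt.not_ge ((le_max_left _ _).trans hz)
      · have h0' : 0 < t := lt_of_le_of_ne ht.1 (Ne.symm h0)
        have hY : Y (G (t • z)) ∈ modelBox := by
          by_contra hn
          exact smul_notMem_modelBox hn ((one_le_inv₀ h0').2 ht.2) hb
        have := hcw _ hY
        rw [norm_smul, norm_inv, Real.norm_of_nonneg h0'.le, inv_mul_lt_iff₀ h0'] at hlt
        rw [norm_smul, Real.norm_of_nonneg h0'.le] at this
        nlinarith
    left
    beta_reduce
    rw [modelMap_eq_of_notMem hout]
    simp [e3pt]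
  · intro z; simp [modelMapC]
  · intro z; simp [hF]

/-- `ℝ⁴` with its quaternionic multiplication. -/
abbrev toQuat : EucA 4 ≃ₗᵢ[ℝ] Quaternion ℝ := Quaternion.linearIsometryEquivTuple.symm

theorem IsCollapseChart.not_sphereNullhomotopic (h : IsCollapseChart Y x₀)
    {F : EucA 5 → EucA 4} (hF : EqOn F (fun y => modelMap (Y y)) (usph 5)) :
    ¬ SphereNullhomotopic F := by
  rintro ⟨c, hc, H, hH, hmaps, hH0, hH1⟩
  obtain ⟨G, hG, hmem, hG0, hinj, hlim, hd⟩ := h.exists_stereographic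
  have hanti : -x₀ ∈ usph 5 := by
    rw [usph, mem_sphere_zero_iff_norm, norm_neg, h.norm_eq_one]
  have hHG : ContinuousOn (fun q : ℝ × EucA 4 => H q.1 (G q.2)) (Icc 0 1 ×ˢ univ) :=
    hH.comp (f := fun q : ℝ × EucA 4 => (q.1, G q.2)) (by fun_prop)
      fun q hq => ⟨hq.1, hmem q.2⟩
  have hHa : ContinuousOn (fun t => H t (-x₀)) (Icc 0 1) :=
    hH.comp (f := fun t : ℝ => (t, -x₀)) (by fun_prop) fun t ht => ⟨ht, hanti⟩
  have hn : ∀ t ∈ Icc (0 : ℝ) 1, ∀ y ∈ usph 5, ‖H t y‖ = 1 := fun t ht y hy =>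
    mem_sphere_zero_iff_norm.1 (hmaps t ht hy)
  let FG : C(EucA 4, EucA 4) := ⟨fun z => H 0 (G z), by
    rw [← continuousOn_univ]
    exact hHG.comp (f := fun z : EucA 4 => ((0 : ℝ), z)) (by fun_prop)
      fun z _ => ⟨left_mem_Icc.2 zero_le_one, mem_univ _⟩⟩
  have hFG : ∀ z, FG z = modelMap (Y (G z)) := fun z => (hH0 (hmem z)).trans (hF (hmem z))
  refine not_admHomotopic_const ((admHomotopic_hopfPolyC_modelMapC.trans
    (h.admHomotopic_modelMapC hG hmem hG0 hinj hlim hd FG hFG)).trans ?_)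
  have hunif : ∃ R, ∀ z, R ≤ ‖z‖ → ∀ t ∈ Icc (0 : ℝ) 1, ‖H t (G z) - H t (-x₀)‖ < 1 := by
    have huc := (isCompact_Icc.prod (isCompact_sphere (0 : EucA 5) 1)).uniformContinuousOn_of_continuous
      hH
    rw [Metric.uniformContinuousOn_iff] at huc
    obtain ⟨δ, hδ, huc⟩ := huc 1 one_pos
    obtain ⟨R, -, hR⟩ := (hasBasis_cobounded_norm (E := EucA 4)).mem_iff.1
      (hlim.eventually (Metric.ball_mem_nhds _ hδ))
    refine ⟨R, fun z hz t ht => ?_⟩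
    rw [← dist_eq_norm]
    refine huc (t, G z) ⟨ht, hmem z⟩ (t, -x₀) ⟨ht, hanti⟩ ?_
    rw [Prod.dist_eq, dist_self]
    exact max_lt hδ (hR hz)
  obtain ⟨R, hR⟩ := hunif
  have ha0 : H 0 (-x₀) = e3pt := by
    rw [hH0 hanti, hF hanti]
    exact modelMap_eq_of_notMem h.antipode.self_of_nhds
  have hnormq : ∀ a p b : EucA 4, ‖toQuat.symm (toQuat a * star (toQuat p) * toQuat b)‖ =
      ‖a‖ * ‖p‖ * ‖b‖ := fun a p b => by
    rw [LinearIsometryEquiv.norm_map, norm_mul, norm_mul, norm_star]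
    simp only [LinearIsometryEquiv.norm_map]
  have hcancel : ∀ a p : EucA 4, ‖p‖ = 1 →
      toQuat.symm (toQuat a * star (toQuat p) * toQuat p) = a := fun a p hp => by
    rw [mul_assoc, Quaternion.star_mul_self, Quaternion.normSq_eq_norm_mul_self,
      LinearIsometryEquiv.norm_map, hp, mul_one, Quaternion.coe_one, mul_one,
      LinearIsometryEquiv.symm_apply_apply]
  have hsub : ∀ a p b b' : EucA 4, toQuat.symm (toQuat a * star (toQuat p) * toQuat b) -
      toQuat.symm (toQuat a * star (toQuat p) * toQuat b') =
      toQuat.symm (toQuat a * star (toQuat p) * toQuat (b - b')) := fun a p b b' => by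
    rw [← map_sub, ← mul_sub, ← map_sub]
  refine admHomotopic_of_continuousOn (ρ := R) (fun t z => toQuat.symm
    (toQuat e3pt * star (toQuat (H t (-x₀))) * toQuat (H t (G z)))) ?_ ?_ ?_ ?_
  · refine toQuat.symm.continuous.comp_continuousOn ?_
    refine (continuousOn_const.mul ?_).mul (toQuat.continuous.comp_continuousOn hHG)
    exact (continuous_star.comp toQuat.continuous).comp_continuousOn
      (hHa.comp continuousOn_fst fun q hq => hq.1)
  · refine fun t ht => ⟨fun z => norm_ne_zero_iff.1 ?_, fun z hz => Or.inl fun h2 => ?_⟩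
    · rw [hnormq, norm_e3pt, hn t ht _ hanti, hn t ht _ (hmem z)]; norm_num
    · have h1 := hsub e3pt (H t (-x₀)) (H t (G z)) (H t (-x₀))
      rw [hcancel _ _ (hn t ht _ hanti)] at h1
      have h3 := congrArg norm h1
      rw [hnormq, norm_e3pt, hn t ht _ hanti, one_mul, one_mul] at h3
      have h5 := (PiLp.norm_apply_le (toQuat.symm (toQuat e3pt * star (toQuat (H t (-x₀))) *
        toQuat (H t (G z))) - e3pt) 2).trans_lt (h3.trans_lt (hR z hz t ht))
      rw [PiLp.sub_apply, h2] at h5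
      simp [e3pt] at h5
  · intro z
    rw [ha0, Quaternion.self_mul_star, Quaternion.normSq_eq_norm_mul_self,
      LinearIsometryEquiv.norm_map, norm_e3pt, mul_one, Quaternion.coe_one, one_mul,
      LinearIsometryEquiv.symm_apply_apply]
    rfl
  · intro z
    rw [hH1 hanti, hH1 (hmem z)]
    exact hcancel _ _ (mem_sphere_zero_iff_norm.1 hc)

end SphereHomotopy

section PhaseStage

open Filter Topology

variable {E : Type*} {K : ℝ} {ζ : E → ℂ} {ρ : E → ℝ} {y : E}

/-- `ζ` rotated by the angle `-K ρ`. -/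
def unwound (K : ℝ) (ζ : E → ℂ) (ρ : E → ℝ) (y : E) : ℂ :=
  ζ y * Complex.exp (-((K * ρ y : ℝ) * Complex.I))

/-- The argument of `ζ` relative to the rapidly rotating frame `exp (i K ρ)`. -/
def phase (K : ℝ) (ζ : E → ℂ) (ρ : E → ℝ) (y : E) : ℝ := (unwound K ζ ρ y).arg

/-- The function `ρ` corrected so that `K` times it is a lift of the argument of `ζ`. -/
def twist (K : ℝ) (ζ : E → ℂ) (ρ : E → ℝ) (y : E) : ℝ := ρ y + phase K ζ ρ y / K

theorem abs_twist_sub_le (hK : 0 < K) (y : E) : |twist K ζ ρ y - ρ y| ≤ Real.pi / K := by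
  rw [twist, add_sub_cancel_left, abs_div, abs_of_pos hK]
  exact div_le_div_of_nonneg_right (Complex.abs_arg_le_pi _) hK.le

theorem unwound_ne_zero (hy : ζ y ≠ 0) : unwound K ζ ρ y ≠ 0 :=
  mul_ne_zero hy (Complex.exp_ne_zero _)

theorem phase_eq_comp : phase K ζ ρ = Complex.imCLM ∘ Complex.log ∘ unwound K ζ ρ := by
  ext y; simp [phase, Complex.log_im]

variable [NormedAddCommGroup E] [NormedSpace ℝ E]

/-- The differential of the argument of `ζ`. -/
def angleForm (ζ : E → ℂ) (y v : E) : ℝ := (fderiv ℝ ζ y v / ζ y).im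

theorem hasFDerivAt_unwound {ζ' : E →L[ℝ] ℂ} {ρ' : E →L[ℝ] ℝ} (hζ : HasFDerivAt ζ ζ' y)
    (hρ : HasFDerivAt ρ ρ' y) : ∃ U' : E →L[ℝ] ℂ, HasFDerivAt (unwound K ζ ρ) U' y ∧
      ∀ v, U' v = (ζ' v - ζ y * (K * ρ' v : ℝ) * Complex.I) *
        Complex.exp (-((K * ρ y : ℝ) * Complex.I)) := by
  have h1 : HasFDerivAt (fun y => ((K * ρ y : ℝ) : ℂ)) (Complex.ofRealCLM.comp (K • ρ')) y :=
    Complex.ofRealCLM.hasFDerivAt.comp y (hρ.const_mul K)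
  have h2 := (h1.mul_const Complex.I).neg.cexp
  refine ⟨_, hζ.mul h2, fun v => ?_⟩
  simp
  ring

theorem phase_stage (hK : K ≠ 0) (hζ : ContDiffAt ℝ 1 ζ y) (hρ : ContDiffAt ℝ 1 ρ y)
    (hy : ζ y ≠ 0) :
    (∀ᶠ y' in 𝓝 y, Real.pi / 2 < |phase K ζ ρ y'|) ∨
      (ContDiffAt ℝ 1 (phase K ζ ρ) y ∧ ContDiffAt ℝ 1 (twist K ζ ρ) y ∧
        (∀ v, fderiv ℝ (phase K ζ ρ) y v = angleForm ζ y v - K * fderiv ℝ ρ y v) ∧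
        ∀ v, fderiv ℝ (twist K ζ ρ) y v = angleForm ζ y v / K) := by
  have hUc : ContDiffAt ℝ 1 (unwound K ζ ρ) y := by
    refine hζ.mul (ContDiffAt.cexp ?_)
    refine ContDiffAt.neg (ContDiffAt.mul ?_ contDiffAt_const)
    exact Complex.ofRealCLM.contDiff.contDiffAt.comp y (contDiffAt_const.mul hρ)
  by_cases hU : unwound K ζ ρ y ∈ Complex.slitPlane
  · right
    have hcd : ContDiffAt ℝ 1 (phase K ζ ρ) y := by
      have h := (Complex.contDiffAt_log (n := 1) hU).restrict_scalars ℝ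
      rw [phase_eq_comp]
      exact Complex.imCLM.contDiff.contDiffAt.comp y (h.comp y hUc)
    have hζd := (hζ.differentiableAt one_ne_zero).hasFDerivAt
    have hρd := (hρ.differentiableAt one_ne_zero).hasFDerivAt
    obtain ⟨U', hU', hU'v⟩ := hasFDerivAt_unwound (K := K) hζd hρd
    have hder : HasFDerivAt (phase K ζ ρ) (Complex.imCLM.comp
        (((ContinuousLinearMap.toSpanSingleton ℂ (unwound K ζ ρ y)⁻¹).restrictScalars ℝ).comp U'))
        y := by
      have h := ((Complex.hasStrictDerivAt_log hU).hasDerivAt.hasFDerivAt).restrictScalars ℝ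
      rw [phase_eq_comp]
      exact Complex.imCLM.hasFDerivAt.comp y (h.comp y hU')
    have hph : ∀ v, fderiv ℝ (phase K ζ ρ) y v = angleForm ζ y v - K * fderiv ℝ ρ y v := by
      intro v
      rw [hder.fderiv]
      have he := Complex.exp_ne_zero (-((K * ρ y : ℝ) * Complex.I))
      have : U' v * (unwound K ζ ρ y)⁻¹ =
          fderiv ℝ ζ y v / ζ y - ((K * fderiv ℝ ρ y v : ℝ) : ℂ) * Complex.I := by
        rw [hU'v, unwound]
        field_simp
      change (U' v * (unwound K ζ ρ y)⁻¹).im = _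
      rw [this, angleForm]
      simp
    have hdd := (hcd.differentiableAt one_ne_zero).hasFDerivAt
    refine ⟨hcd, hρ.add (hcd.div_const K), hph, fun v => ?_⟩
    have : HasFDerivAt (twist K ζ ρ) (fderiv ℝ ρ y + K⁻¹ • fderiv ℝ (phase K ζ ρ) y) y := by
      refine hρd.add ?_
      simpa only [div_eq_mul_inv] using hdd.mul_const K⁻¹
    rw [this.fderiv]
    simp only [add_apply, smul_apply, hph, smul_eq_mul]
    field_simp
    ring
  · left
    have hre : (unwound K ζ ρ y).re < 0 := by
      rw [Complex.mem_slitPlane_iff, not_or, not_not, not_lt] at hU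
      refine lt_of_le_of_ne hU.1 fun h => unwound_ne_zero (K := K) (ρ := ρ) hy ?_
      exact Complex.ext h hU.2
    filter_upwards [(Complex.continuous_re.continuousAt.comp hUc.continuousAt).eventually_lt_const
      hre] with y' hy'
    by_contra hle
    exact hy'.not_ge (Complex.abs_arg_le_pi_div_two_iff.1 (not_lt.1 hle))

end PhaseStage

section SphereChart

open Filter Topology

/-- The first complex coordinate on `ℝ⁵ = ℂ² × ℝ`. -/
def linkA (y : EucA 5) : ℂ := ⟨y 0, y 1⟩

/-- The second complex coordinate on `ℝ⁵ = ℂ² × ℝ`. -/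
def linkB (y : EucA 5) : ℂ := ⟨y 2, y 3⟩

/-- A function on `S⁴` whose argument is the third angular coordinate. -/
def linkC (y : EucA 5) : ℂ := ⟨2 * (y 0 ^ 2 + y 1 ^ 2) - 1, y 4⟩

/-- The transverse coordinate of the torus. -/
def torusHeight (y : EucA 5) : ℝ := 10 * ((2 * (y 0 ^ 2 + y 1 ^ 2) - 1) ^ 2 + y 4 ^ 2 - 49 / 625)

/-- The height after unwinding one angle. -/
def heightOne (N : ℝ) : EucA 5 → ℝ := twist N linkC torusHeight

/-- The height after unwinding two angles. -/
def heightTwo (N : ℝ) : EucA 5 → ℝ := twist (N ^ 2) linkB (heightOne N)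

/-- Coordinates on a spiralling neighbourhood in `S⁴`: three angles and a very flat height. -/
def spiralChart (N : ℝ) (y : EucA 5) : EucA 4 :=
  !₂[phase (N ^ 3) linkA (heightTwo N) y, phase (N ^ 2) linkB (heightOne N) y,
    phase N linkC torusHeight y, twist (N ^ 3) linkA (heightTwo N) y]

/-- The centre of the coordinates. -/
def spiralCentre : EucA 5 := !₂[4 / 5, 0, 3 / 5, 0, 0]

theorem hasFDerivAt_complex_mk {E : Type*} [NormedAddCommGroup E] [NormedSpace ℝ E] {f g : E → ℝ}
    {f' g' : E →L[ℝ] ℝ} {y : E} (hf : HasFDerivAt f f' y) (hg : HasFDerivAt g g' y) :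
    HasFDerivAt (fun y => (⟨f y, g y⟩ : ℂ))
      ((Complex.equivRealProdCLM.symm : ℝ × ℝ →L[ℝ] ℂ).comp (f'.prod g')) y :=
  (Complex.equivRealProdCLM.symm : ℝ × ℝ →L[ℝ] ℂ).hasFDerivAt.comp y (hf.prodMk hg)

theorem contDiff_complex_mk {E : Type*} [NormedAddCommGroup E] [NormedSpace ℝ E] {f g : E → ℝ}
    (hf : ContDiff ℝ 1 f) (hg : ContDiff ℝ 1 g) : ContDiff ℝ 1 fun y => (⟨f y, g y⟩ : ℂ) :=
  (Complex.equivRealProdCLM.symm : ℝ × ℝ →L[ℝ] ℂ).contDiff.comp (hf.prodMk hg)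

theorem contDiff_linkA : ContDiff ℝ 1 linkA := contDiff_complex_mk (by fun_prop) (by fun_prop)

theorem contDiff_linkB : ContDiff ℝ 1 linkB := contDiff_complex_mk (by fun_prop) (by fun_prop)

theorem contDiff_linkC : ContDiff ℝ 1 linkC := contDiff_complex_mk (by fun_prop) (by fun_prop)

theorem contDiff_torusHeight : ContDiff ℝ 1 torusHeight := by unfold torusHeight; fun_prop

theorem hasFDerivAt_coord (i : Fin 5) (y : EucA 5) :
    HasFDerivAt (fun y : EucA 5 => y i) (EuclideanSpace.proj i : EucA 5 →L[ℝ] ℝ) y :=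
  (EuclideanSpace.proj i : EucA 5 →L[ℝ] ℝ).hasFDerivAt

theorem fderiv_linkA (y v : EucA 5) : fderiv ℝ linkA y v = ⟨v 0, v 1⟩ := by
  rw [HasFDerivAt.fderiv (f := linkA)
    (hasFDerivAt_complex_mk (hasFDerivAt_coord 0 y) (hasFDerivAt_coord 1 y))]
  rfl

theorem fderiv_linkB (y v : EucA 5) : fderiv ℝ linkB y v = ⟨v 2, v 3⟩ := by
  rw [HasFDerivAt.fderiv (f := linkB)
    (hasFDerivAt_complex_mk (hasFDerivAt_coord 2 y) (hasFDerivAt_coord 3 y))]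
  rfl

theorem hasFDerivAt_linkC_re (y : EucA 5) : ∃ D : EucA 5 →L[ℝ] ℝ,
    HasFDerivAt (fun y : EucA 5 => 2 * (y 0 ^ 2 + y 1 ^ 2) - 1) D y ∧
      ∀ v, D v = 4 * (y 0 * v 0 + y 1 * v 1) := by
  refine ⟨_, ((((hasFDerivAt_coord 0 y).pow 2).add ((hasFDerivAt_coord 1 y).pow 2)).const_mul
    2).sub_const 1, fun v => ?_⟩
  simp
  ring

theorem fderiv_linkC (y v : EucA 5) :
    fderiv ℝ linkC y v = ⟨4 * (y 0 * v 0 + y 1 * v 1), v 4⟩ := by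
  obtain ⟨D, hD, hDv⟩ := hasFDerivAt_linkC_re y
  rw [HasFDerivAt.fderiv (f := linkC) (hasFDerivAt_complex_mk hD (hasFDerivAt_coord 4 y)), ← hDv]
  rfl

theorem fderiv_torusHeight (y v : EucA 5) : fderiv ℝ torusHeight y v =
    20 * ((2 * (y 0 ^ 2 + y 1 ^ 2) - 1) * (4 * (y 0 * v 0 + y 1 * v 1)) + y 4 * v 4) := by
  obtain ⟨D, hD, hDv⟩ := hasFDerivAt_linkC_re y
  rw [HasFDerivAt.fderiv (f := torusHeight)
    ((((hD.pow 2).add ((hasFDerivAt_coord 4 y).pow 2)).sub_const (49 / 625)).const_mul 10)]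
  simp [hDv]
  ring

theorem sum_sq_of_mem_usph {y : EucA 5} (hy : y ∈ usph 5) :
    y 0 ^ 2 + y 1 ^ 2 + y 2 ^ 2 + y 3 ^ 2 + y 4 ^ 2 = 1 := by
  have h := EuclideanSpace.norm_sq_eq y
  rw [mem_sphere_zero_iff_norm.1 hy, Fin.sum_univ_five] at h
  simpa using h.symm

theorem link_bounds {y : EucA 5} (hy : y ∈ usph 5) (hh : |torusHeight y| ≤ 2 / 5) :
    1 / 4 ≤ ‖linkA y‖ ^ 2 ∧ 1 / 16 ≤ ‖linkB y‖ ^ 2 ∧ 1 / 36 ≤ ‖linkC y‖ ^ 2 := by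
  have hs := sum_sq_of_mem_usph hy
  obtain ⟨h1, h2⟩ := abs_le.1 hh
  simp only [← Complex.normSq_eq_norm_sq, Complex.normSq_apply, linkA, linkB, linkC]
  rw [torusHeight] at h1 h2
  have h3 : (2 * (y 0 ^ 2 + y 1 ^ 2) - 1) ^ 2 ≤ 3 / 25 := by nlinarith [sq_nonneg (y 4)]
  refine ⟨by nlinarith, ?_, by nlinarith⟩
  have h4 : y 4 ^ 2 ≤ 3 / 25 := by nlinarith [sq_nonneg (2 * (y 0 ^ 2 + y 1 ^ 2) - 1)]
  nlinarith

theorem norm_complex_mk_le (a b : ℝ) : ‖(⟨a, b⟩ : ℂ)‖ ≤ |a| + |b| :=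
  Complex.norm_le_abs_re_add_abs_im _

theorem abs_angleForm_le {E : Type*} [NormedAddCommGroup E] [NormedSpace ℝ E] {ζ : E → ℂ} {y v : E}
    {r b : ℝ} (hr : 0 < r) (h : r ^ 2 ≤ ‖ζ y‖ ^ 2) (hb : ‖fderiv ℝ ζ y v‖ ≤ b) :
    |angleForm ζ y v| ≤ b / r := by
  refine (Complex.abs_im_le_norm _).trans ?_
  rw [norm_div]
  have : r ≤ ‖ζ y‖ := le_of_sq_le_sq h (norm_nonneg _)
  exact div_le_div₀ ((norm_nonneg _).trans hb) hb hr this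

theorem angleForm_bounds {y : EucA 5} (hy : y ∈ usph 5) (hh : |torusHeight y| ≤ 2 / 5)
    (v : EucA 5) : |angleForm linkA y v| ≤ 4 * ‖v‖ ∧ |angleForm linkB y v| ≤ 8 * ‖v‖ ∧
      |angleForm linkC y v| ≤ 54 * ‖v‖ ∧ |fderiv ℝ torusHeight y v| ≤ 180 * ‖v‖ := by
  obtain ⟨hA, hB, hC⟩ := link_bounds hy hh
  have hc : ∀ i, |v i| ≤ ‖v‖ := fun i => by simpa using PiLp.norm_apply_le v i
  have hyc : ∀ i, |y i| ≤ 1 := fun i => by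
    simpa [mem_sphere_zero_iff_norm.1 hy] using PiLp.norm_apply_le y i
  have hm : ∀ i, |y i * v i| ≤ ‖v‖ := fun i => by
    rw [abs_mul]; nlinarith [abs_nonneg (v i), hc i, hyc i, abs_nonneg (y i)]
  have h8 : |4 * (y 0 * v 0 + y 1 * v 1)| ≤ 8 * ‖v‖ := by
    rw [abs_mul, abs_of_pos (by norm_num : (0 : ℝ) < 4)]
    linarith [abs_add_le (y 0 * v 0) (y 1 * v 1), hm 0, hm 1]
  refine ⟨?_, ?_, ?_, ?_⟩
  · refine (abs_angleForm_le (r := 1 / 2) (b := 2 * ‖v‖) (by norm_num) (by linarith) ?_).trans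
      (by linarith)
    rw [fderiv_linkA]
    linarith [norm_complex_mk_le (v 0) (v 1), hc 0, hc 1]
  · refine (abs_angleForm_le (r := 1 / 4) (b := 2 * ‖v‖) (by norm_num) (by linarith) ?_).trans
      (by linarith)
    rw [fderiv_linkB]
    linarith [norm_complex_mk_le (v 2) (v 3), hc 2, hc 3]
  · refine (abs_angleForm_le (r := 1 / 6) (b := 9 * ‖v‖) (by norm_num) (by linarith) ?_).trans
      (by linarith)
    rw [fderiv_linkC]
    linarith [norm_complex_mk_le (4 * (y 0 * v 0 + y 1 * v 1)) (v 4), hc 4]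
  · rw [fderiv_torusHeight, abs_mul, abs_of_pos (by norm_num : (0 : ℝ) < 20)]
    have hs := sum_sq_of_mem_usph hy
    have h1 : |2 * (y 0 ^ 2 + y 1 ^ 2) - 1| ≤ 1 := abs_le.2
      ⟨by nlinarith [sq_nonneg (y 0), sq_nonneg (y 1)],
        by nlinarith [sq_nonneg (y 2), sq_nonneg (y 3), sq_nonneg (y 4)]⟩
    have h2 : |(2 * (y 0 ^ 2 + y 1 ^ 2) - 1) * (4 * (y 0 * v 0 + y 1 * v 1))| ≤ 8 * ‖v‖ := by
      rw [abs_mul]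
      nlinarith [abs_nonneg (4 * (y 0 * v 0 + y 1 * v 1)), abs_nonneg (2 * (y 0 ^ 2 + y 1 ^ 2) - 1)]
    linarith [abs_add_le ((2 * (y 0 ^ 2 + y 1 ^ 2) - 1) * (4 * (y 0 * v 0 + y 1 * v 1)))
      (y 4 * v 4), hm 4]

theorem notMem_modelBox_of_lt_abs_phase {N : ℝ} {y : EucA 5}
    (h : Real.pi / 2 < |phase (N ^ 3) linkA (heightTwo N) y| ∨
      Real.pi / 2 < |phase (N ^ 2) linkB (heightOne N) y| ∨
      Real.pi / 2 < |phase N linkC torusHeight y|) : spiralChart N y ∉ modelBox := by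
  rintro ⟨h0, h1, h2, -⟩
  rcases h with h | h | h
  · exact h.not_ge h0
  · exact h.not_ge h1
  · exact h.not_ge h2

theorem abs_sub_torusHeight_le {N : ℝ} (hN : 1000 ≤ N) (y : EucA 5) :
    |twist (N ^ 3) linkA (heightTwo N) y - torusHeight y| ≤ 1 / 50 := by
  have h1 := abs_twist_sub_le (K := N) (ζ := linkC) (ρ := torusHeight) (by linarith) y
  have h2 := abs_twist_sub_le (K := N ^ 2) (ζ := linkB) (ρ := heightOne N) (by positivity) y
  have h3 := abs_twist_sub_le (K := N ^ 3) (ζ := linkA) (ρ := heightTwo N) (by positivity) y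
  have hpi : ∀ {M : ℝ}, 1000 ≤ M → Real.pi / M ≤ 1 / 250 := fun {M} hM => by
    rw [div_le_iff₀ (by linarith)]; linarith [Real.pi_lt_four]
  have hN2 : 1000 ≤ N ^ 2 := by nlinarith
  have hN3 : 1000 ≤ N ^ 3 := by nlinarith
  have e1 := abs_le.1 (h1.trans (hpi hN))
  have e2 := abs_le.1 (h2.trans (hpi hN2))
  have e3 := abs_le.1 (h3.trans (hpi hN3))
  have d1 : heightOne N y = twist N linkC torusHeight y := rfl
  have d2 : heightTwo N y = twist (N ^ 2) linkB (heightOne N) y := rfl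
  rw [abs_le]
  constructor <;> linarith

theorem spiralChart_local {N : ℝ} (hN : 1000 ≤ N) {y : EucA 5} (hy : y ∈ usph 5) :
    (∀ᶠ y' in 𝓝 y, spiralChart N y' ∉ modelBox) ∨
      (|torusHeight y| ≤ 2 / 5 ∧ ContDiffAt ℝ 1 (spiralChart N) y ∧
        ∀ v, fderiv ℝ (spiralChart N) y v =
          !₂[angleForm linkA y v - N * angleForm linkB y v,
            angleForm linkB y v - N * angleForm linkC y v,
            angleForm linkC y v - N * fderiv ℝ torusHeight y v, angleForm linkA y v / N ^ 3]) := by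
  have hN0 : N ≠ 0 := by linarith
  by_cases hh : |torusHeight y| ≤ 2 / 5
  swap
  · left
    filter_upwards [(contDiff_torusHeight.continuous.abs.continuousAt).eventually_const_lt
      (not_le.1 hh)] with y' hy' hb
    have h1 : |twist (N ^ 3) linkA (heightTwo N) y'| ≤ 7 / 20 := hb.2.2.2
    have h2 := abs_sub_abs_le_abs_sub (torusHeight y') (twist (N ^ 3) linkA (heightTwo N) y')
    rw [abs_sub_comm] at h2
    linarith [abs_sub_torusHeight_le hN y']
  obtain ⟨hA, hB, hC⟩ := link_bounds hy hh
  have hne : ∀ {z : ℂ} {r : ℝ}, 0 < r → r ≤ ‖z‖ ^ 2 → z ≠ 0 := by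
    rintro z r hr h rfl
    norm_num at h
    linarith
  rcases phase_stage hN0 contDiff_linkC.contDiffAt contDiff_torusHeight.contDiffAt
    (hne (by norm_num) hC) with h | ⟨hp3, ht3, dp3, dt3⟩
  · exact Or.inl (h.mono fun y' h' => notMem_modelBox_of_lt_abs_phase (Or.inr (Or.inr h')))
  rcases phase_stage (K := N ^ 2) (ρ := heightOne N) (pow_ne_zero 2 hN0) contDiff_linkB.contDiffAt
    ht3 (hne (by norm_num) hB) with h | ⟨hp2, ht2, dp2, dt2⟩
  · exact Or.inl (h.mono fun y' h' => notMem_modelBox_of_lt_abs_phase (Or.inr (Or.inl h')))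
  rcases phase_stage (K := N ^ 3) (ρ := heightTwo N) (pow_ne_zero 3 hN0) contDiff_linkA.contDiffAt
    ht2 (hne (by norm_num) hA) with h | ⟨hp1, ht1, dp1, dt1⟩
  · exact Or.inl (h.mono fun y' h' => notMem_modelBox_of_lt_abs_phase (Or.inl h'))
  have hcd : ContDiffAt ℝ 1 (spiralChart N) y := by
    rw [contDiffAt_euclidean]
    intro i
    fin_cases i
    exacts [hp1, hp2, hp3, ht1]
  refine Or.inr ⟨hh, hcd, fun v => ?_⟩
  have hi : ∀ i, fderiv ℝ (spiralChart N) y v i = fderiv ℝ (fun y => spiralChart N y i) y v := by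
    intro i
    have := (EuclideanSpace.proj i : EucA 4 →L[ℝ] ℝ).hasFDerivAt.comp y
      (hcd.differentiableAt one_ne_zero).hasFDerivAt
    exact (congrArg (fun L : EucA 5 →L[ℝ] ℝ => L v) this.fderiv).symm
  ext i
  rw [hi]
  fin_cases i
  · refine (dp1 v).trans ?_
    change _ - N ^ 3 * fderiv ℝ (twist (N ^ 2) linkB (heightOne N)) y v = _
    rw [dt2]
    simp only [Fin.zero_eta, Matrix.cons_val]
    field_simp
  · refine (dp2 v).trans ?_
    change _ - N ^ 2 * fderiv ℝ (twist N linkC torusHeight) y v = _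
    rw [dt3]
    simp only [Fin.mk_one, Matrix.cons_val]
    field_simp
  · exact dp3 v
  · exact dt1 v

theorem norm_spiralCentre : ‖spiralCentre‖ = 1 := by
  rw [EuclideanSpace.norm_eq, Real.sqrt_eq_one]
  simp only [spiralCentre, Fin.sum_univ_five, Real.norm_eq_abs, sq_abs, Matrix.cons_val]
  norm_num

theorem phase_eq_zero_of_pos {E : Type*} {ζ : E → ℂ} {ρ : E → ℝ} {y : E} (K : ℝ) {r : ℝ}
    (hζ : ζ y = r) (hr : 0 ≤ r) (hρ : ρ y = 0) : phase K ζ ρ y = 0 := by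
  simp [phase, unwound, hζ, hρ, Complex.arg_ofReal_of_nonneg hr]

theorem spiralChart_centre (N : ℝ) : spiralChart N spiralCentre = 0 := by
  have hA : linkA spiralCentre = (4 / 5 : ℝ) := by
    apply Complex.ext <;> simp [linkA, spiralCentre]
  have hB : linkB spiralCentre = (3 / 5 : ℝ) := by
    apply Complex.ext <;> simp [linkB, spiralCentre]
  have hC : linkC spiralCentre = (7 / 25 : ℝ) := by
    apply Complex.ext <;> simp [linkC, spiralCentre]; norm_num
  have hh : torusHeight spiralCentre = 0 := by
    simp [torusHeight, spiralCentre]; norm_num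
  have p3 : phase N linkC torusHeight spiralCentre = 0 :=
    phase_eq_zero_of_pos N hC (by norm_num) hh
  have h1 : heightOne N spiralCentre = 0 := by rw [heightOne, twist, p3, hh]; simp
  have p2 : phase (N ^ 2) linkB (heightOne N) spiralCentre = 0 :=
    phase_eq_zero_of_pos _ hB (by norm_num) h1
  have h2 : heightTwo N spiralCentre = 0 := by rw [heightTwo, twist, p2, h1]; simp
  have p1 : phase (N ^ 3) linkA (heightTwo N) spiralCentre = 0 :=
    phase_eq_zero_of_pos _ hA (by norm_num) h2
  ext i
  fin_cases i <;> simp [spiralChart, p1, p2, p3, twist, h2]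

end SphereChart

section Assembly

open Filter Topology

theorem zero_mem_modelBox : (0 : EucA 4) ∈ modelBox := by
  have := Real.pi_pos
  refine ⟨?_, ?_, ?_, ?_⟩ <;> simp <;> positivity

theorem spiralChart_eq_zero {N : ℝ} {y : EucA 5} (hy : y ∈ usph 5) (h : spiralChart N y = 0) :
    y = spiralCentre := by
  have p1 : phase (N ^ 3) linkA (heightTwo N) y = 0 := congrArg (fun v : EucA 4 => v 0) h
  have p2 : phase (N ^ 2) linkB (heightOne N) y = 0 := congrArg (fun v : EucA 4 => v 1) h
  have p3 : phase N linkC torusHeight y = 0 := congrArg (fun v : EucA 4 => v 2) h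
  have h3 : twist (N ^ 3) linkA (heightTwo N) y = 0 := congrArg (fun v : EucA 4 => v 3) h
  have h2 : heightTwo N y = 0 := by rwa [twist, p1, zero_div, add_zero] at h3
  have h1 : heightOne N y = 0 := by
    have := h2; rwa [heightTwo, twist, p2, zero_div, add_zero] at this
  have h0 : torusHeight y = 0 := by
    have := h1; rwa [heightOne, twist, p3, zero_div, add_zero] at this
  rw [phase, unwound, h2] at p1
  rw [phase, unwound, h1] at p2
  rw [phase, unwound, h0] at p3
  simp only [mul_zero, Complex.ofReal_zero, zero_mul, neg_zero, Complex.exp_zero, mul_one,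
    Complex.arg_eq_zero_iff] at p1 p2 p3
  obtain ⟨a0, a1⟩ := p1
  obtain ⟨b0, b1⟩ := p2
  obtain ⟨c0, c1⟩ := p3
  simp only [linkA] at a0 a1
  simp only [linkB] at b0 b1
  simp only [linkC] at c0 c1
  have hs := sum_sq_of_mem_usph hy
  rw [torusHeight] at h0
  rw [a1, c1] at h0 hs
  rw [a1] at c0
  rw [b1] at hs
  have e0 : 2 * y 0 ^ 2 - 1 = 7 / 25 := by
    have h7 : (2 * y 0 ^ 2 - 1 - 7 / 25) * (2 * y 0 ^ 2 - 1 + 7 / 25) = 0 := by linarith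
    rcases mul_eq_zero.1 h7 with h7 | h7
    · linarith
    · exfalso; linarith
  have y0 : y 0 = 4 / 5 := by
    have h7 : (y 0 - 4 / 5) * (y 0 + 4 / 5) = 0 := by linarith
    rcases mul_eq_zero.1 h7 with h7 | h7 <;> linarith
  have y2 : y 2 = 3 / 5 := by
    have h7 : (y 2 - 3 / 5) * (y 2 + 3 / 5) = 0 := by rw [y0] at hs; linarith
    rcases mul_eq_zero.1 h7 with h7 | h7 <;> linarith
  ext i
  fin_cases i
  exacts [y0, a1, y2, b1, c1]

theorem spiralChart_neg_centre_notMem (N : ℝ) : spiralChart N (-spiralCentre) ∉ modelBox := by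
  have hC : linkC (-spiralCentre) = (7 / 25 : ℝ) := by
    apply Complex.ext <;> simp [linkC, spiralCentre]; norm_num
  have hB : linkB (-spiralCentre) = (-(3 / 5) : ℝ) := by
    apply Complex.ext <;> simp [linkB, spiralCentre]
  have hh : torusHeight (-spiralCentre) = 0 := by
    simp [torusHeight, spiralCentre]; norm_num
  have h1 : heightOne N (-spiralCentre) = 0 := by
    rw [heightOne, twist, phase_eq_zero_of_pos N hC (by norm_num) hh, hh]; simp
  refine notMem_modelBox_of_lt_abs_phase (Or.inr (Or.inl ?_))
  rw [phase, unwound, h1, hB]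
  simp only [mul_zero, Complex.ofReal_zero, zero_mul, neg_zero, Complex.exp_zero, mul_one]
  rw [Complex.arg_ofReal_of_neg (by norm_num), abs_of_pos Real.pi_pos]
  linarith [Real.pi_pos]

theorem isCollapseChart_spiralChart {N : ℝ} (hN : 1000 ≤ N) :
    IsCollapseChart (spiralChart N) spiralCentre where
  norm_eq_one := norm_spiralCentre
  continuousAt y hy := (spiralChart_local hN hy).imp_right fun h => h.2.1.continuousAt
  apply_eq_zero := spiralChart_centre N
  eq_of_apply_eq_zero y hy h := spiralChart_eq_zero hy h
  antipode := by
    have hm : -spiralCentre ∈ usph 5 := by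
      rw [usph, mem_sphere_zero_iff_norm, norm_neg, norm_spiralCentre]
    rcases spiralChart_local hN hm with h | h
    · exact h
    · exact h.2.1.continuousAt.eventually
        (isCompact_modelBox.isClosed.isOpen_compl.mem_nhds (spiralChart_neg_centre_notMem N))
  deriv := by
    have hm : spiralCentre ∈ usph 5 := mem_sphere_zero_iff_norm.2 norm_spiralCentre
    have hN0 : N ≠ 0 := by linarith
    rcases spiralChart_local hN hm with h | ⟨-, hcd, hd⟩
    · refine (h.self_of_nhds ?_).elim
      rw [spiralChart_centre]
      exact zero_mem_modelBox
    refine ⟨_, (hcd.differentiableAt one_ne_zero).hasFDerivAt, fun v hv hLv => ?_⟩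
    rw [hd] at hLv
    have e0 : angleForm linkA spiralCentre v - N * angleForm linkB spiralCentre v = 0 :=
      congrArg (fun v : EucA 4 => v 0) hLv
    have e1 : angleForm linkB spiralCentre v - N * angleForm linkC spiralCentre v = 0 :=
      congrArg (fun v : EucA 4 => v 1) hLv
    have e2 : angleForm linkC spiralCentre v - N * fderiv ℝ torusHeight spiralCentre v = 0 :=
      congrArg (fun v : EucA 4 => v 2) hLv
    have e3 : angleForm linkA spiralCentre v / N ^ 3 = 0 := congrArg (fun v : EucA 4 => v 3) hLv
    have fA : angleForm linkA spiralCentre v = 0 :=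
      (div_eq_zero_iff.1 e3).resolve_right (pow_ne_zero 3 hN0)
    have fB : angleForm linkB spiralCentre v = 0 :=
      (mul_eq_zero.1 (by linarith : N * angleForm linkB spiralCentre v = 0)).resolve_left hN0
    have fC : angleForm linkC spiralCentre v = 0 :=
      (mul_eq_zero.1 (by linarith : N * angleForm linkC spiralCentre v = 0)).resolve_left hN0
    have fh : fderiv ℝ torusHeight spiralCentre v = 0 :=
      (mul_eq_zero.1 (by linarith : N * fderiv ℝ torusHeight spiralCentre v = 0)).resolve_left hN0
    have hA : linkA spiralCentre = (4 / 5 : ℝ) := by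
      apply Complex.ext <;> simp [linkA, spiralCentre]
    have hB : linkB spiralCentre = (3 / 5 : ℝ) := by
      apply Complex.ext <;> simp [linkB, spiralCentre]
    have hC : linkC spiralCentre = (7 / 25 : ℝ) := by
      apply Complex.ext <;> simp [linkC, spiralCentre]; norm_num
    rw [angleForm, fderiv_linkA, hA, Complex.div_ofReal_im] at fA
    rw [angleForm, fderiv_linkB, hB, Complex.div_ofReal_im] at fB
    rw [angleForm, fderiv_linkC, hC, Complex.div_ofReal_im] at fC
    rw [fderiv_torusHeight] at fh
    simp only [spiralCentre, Matrix.cons_val] at fh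
    have hv' : 4 / 5 * v 0 + 3 / 5 * v 2 = 0 := by
      have := hv
      simp only [PiLp.inner_apply, Fin.sum_univ_five, spiralCentre, Matrix.cons_val] at this
      simp at this
      linarith
    have v1 : v 1 = 0 := by linarith
    have v3 : v 3 = 0 := by linarith
    have v4 : v 4 = 0 := by linarith
    have v0 : v 0 = 0 := by rw [v1, v4] at fh; linarith
    have v2 : v 2 = 0 := by rw [v0] at hv'; linarith
    ext i
    fin_cases i
    exacts [v0, v1, v2, v3, v4]

/-- A function which is `C¹` near a compact set agrees near that set with a `C¹` function. -/
theorem exists_contDiff_eventuallyEq {E F : Type*} [NormedAddCommGroup E] [NormedSpace ℝ E]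
    [FiniteDimensional ℝ E] [NormedAddCommGroup F] [NormedSpace ℝ F] {S : Set E} (hS : IsClosed S)
    {f : E → F} (hf : ∀ y ∈ S, ContDiffAt ℝ 1 f y) :
    ∃ g : E → F, ContDiff ℝ 1 g ∧ ∀ y ∈ S, g =ᶠ[𝓝 y] f := by
  have hΩ : IsOpen {y | ContDiffAt ℝ 1 f y} :=
    isOpen_iff_mem_nhds.2 fun y hy => ContDiffAt.eventually hy (by simp)
  obtain ⟨χ, hχ0, hχ1, -⟩ := exists_contMDiffMap_zero_one_nhds_of_isClosed (n := 1)
    (modelWithCornersSelf ℝ E) hΩ.isClosed_compl hS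
    (disjoint_compl_left_iff_subset.2 hf)
  have hχ : ContDiff ℝ 1 χ := χ.contMDiff.contDiff
  rw [eventually_nhdsSet_iff_forall] at hχ0 hχ1
  refine ⟨fun y => χ y • f y, contDiff_iff_contDiffAt.2 fun y => ?_, fun y hy => ?_⟩
  · by_cases hy : ContDiffAt ℝ 1 f y
    · exact hχ.contDiffAt.smul hy
    · refine (contDiffAt_const (c := (0 : F))).congr_of_eventuallyEq ?_
      filter_upwards [hχ0 y hy] with z hz
      rw [hz, zero_smul]
  · filter_upwards [hχ1 y hy] with z hz
    rw [hz, one_smul]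

theorem EuclideanSpace.norm_le_sum_four (u : EucA 4) : ‖u‖ ≤ |u 0| + |u 1| + |u 2| + |u 3| := by
  rw [EuclideanSpace.norm_eq]
  refine Real.sqrt_le_iff.2 ⟨by positivity, ?_⟩
  simp only [Fin.sum_univ_four, Real.norm_eq_abs]
  have : 0 ≤ |u 0| * |u 1| + |u 0| * |u 2| + |u 0| * |u 3| + |u 1| * |u 2| + |u 1| * |u 3| +
    |u 2| * |u 3| := by positivity
  nlinarith

theorem exists_small_map : ∃ C : ℝ, 0 ≤ C ∧ ∀ N : ℝ, 1000 ≤ N → ∃ F : EucA 5 → EucA 4,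
    ContDiff ℝ 1 F ∧ EqOn F (fun y => modelMap (spiralChart N y)) (usph 5) ∧
      kDilation 3 F ≤ C / N := by
  obtain ⟨C, hC, hCb⟩ := exists_lamNorm_modelMap_le
  refine ⟨C * 640000, by positivity, fun N hN => ?_⟩
  have hN0 : 0 < N := by linarith
  have hcd : ∀ y ∈ usph 5, ContDiffAt ℝ 1 (fun y => modelMap (spiralChart N y)) y := by
    intro y hy
    rcases spiralChart_local hN hy with h | h
    · refine (contDiffAt_const (c := e3pt)).congr_of_eventuallyEq ?_
      exact h.mono fun y' h' => modelMap_eq_of_notMem h'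
    · exact contDiff_modelMap.contDiffAt.comp y h.2.1
  obtain ⟨F, hF, hFeq⟩ := exists_contDiff_eventuallyEq Metric.isClosed_sphere hcd
  refine ⟨F, hF, fun y hy => (hFeq y hy).self_of_nhds, Real.iSup_le (fun x => ?_) (by positivity)⟩
  have hx := x.2
  rw [(hFeq _ hx).fderiv_eq]
  rcases spiralChart_local hN hx with h | ⟨hh, hY, hd⟩
  · have : (fun y => modelMap (spiralChart N y)) =ᶠ[𝓝 (x : EucA 5)] fun _ => e3pt :=
      h.mono fun y' h' => modelMap_eq_of_notMem h'
    rw [this.fderiv_eq, fderiv_const_apply, ContinuousLinearMap.toLinearMap_zero,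
      LinearMap.zero_comp]
    exact lamNorm_three_zero.trans (by positivity)
  rw [fderiv_fun_comp (x : EucA 5) (contDiff_modelMap.differentiable one_ne_zero _)
    (hY.differentiableAt one_ne_zero), ContinuousLinearMap.toLinearMap_comp, LinearMap.comp_assoc]
  refine (hCb _ _ (400 * N) (4 / N ^ 3) (by positivity) (by positivity) fun v hv => ?_).trans
    (le_of_eq ?_)
  swap
  · field_simp; ring
  have hv' : ‖(v : EucA 5)‖ = 1 := hv
  obtain ⟨b1, b2, b3, b4⟩ := angleForm_bounds hx hh v
  rw [hv', mul_one] at b1 b2 b3 b4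
  have hT : ((fderiv ℝ (spiralChart N) (x : EucA 5)).toLinearMap ∘ₗ
      ((ℝ ∙ (x : EucA 5))ᗮ).subtype) v = fderiv ℝ (spiralChart N) x v := rfl
  rw [hT, hd]
  have hstep : ∀ {a b p q : ℝ}, |a| ≤ p → |b| ≤ q → |a - N * b| ≤ p + N * q := fun ha hb => by
    refine (abs_sub _ _).trans (add_le_add ha ?_)
    rw [abs_mul, abs_of_pos hN0]
    exact mul_le_mul_of_nonneg_left hb hN0.le
  have c3 : |angleForm linkA (x : EucA 5) v / N ^ 3| ≤ 4 / N ^ 3 := by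
    rw [abs_div, abs_of_pos (by positivity : 0 < N ^ 3)]
    exact div_le_div_of_nonneg_right b1 (by positivity)
  refine ⟨(EuclideanSpace.norm_le_sum_four _).trans ?_, c3⟩
  have h4 : 4 / N ^ 3 ≤ 4 := div_le_self (by norm_num) (one_le_pow₀ (by linarith))
  simp only [Matrix.cons_val]
  linarith [hstep b1 b2, hstep b2 b3, hstep b3 b4]

end Assembly

/-- For every `ε > 0` there exists a homotopically non-trivial `C¹` map from `S^4` to
`S^3` with `3`-dilation less than `ε`.  (The class of such a map is the suspension of the Hopf fibration, the non-trivial element of `π₄(S³) ≅ ℤ/2`.)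
(`S^4 = usph 5 ⊆ ℝ^5`, `S^3 = usph 4 ⊆ ℝ^4`; a `C¹` map of spheres is
represented by a `C¹` ambient map sending the unit sphere to the unit sphere.) -/
theorem nontrivial_small_3dilation_S4_S3 :
    ∀ ε : ℝ, 0 < ε →
      ∃ F : EucA 5 → EucA 4,
        ContDiff ℝ 1 F ∧
        MapsTo F (usph 5) (usph 4) ∧
        ¬ SphereNullhomotopic F ∧
        kDilation 3 F < ε := by
  intro ε hε
  obtain ⟨C, hC, h⟩ := exists_small_map
  have hN : 1000 ≤ max 1000 ((C + 1) / ε) := le_max_left _ _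
  obtain ⟨F, hF, heq, hdil⟩ := h _ hN
  refine ⟨F, hF, fun y hy => ?_,
    (isCollapseChart_spiralChart hN).not_sphereNullhomotopic heq, hdil.trans_lt ?_⟩
  · rw [heq hy]
    exact mem_sphere_zero_iff_norm.2 (norm_modelMap _)
  · rw [div_lt_iff₀ (by positivity)]
    have := (div_le_iff₀' hε).1 (le_max_right 1000 ((C + 1) / ε))
    linarith
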